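/- Let 865/886 < γ < 1, a ∈ ℤ \ {0}, and A > 0 be fixed, let ε > 0 be sufficiently small, set θ = (443/55)γ − 173/22 − ε and D = X^θ, and suppose γ > 1/2 + θ, X^{1−ε} ≤ N ≤ X, and H = N^{1−γ+ε}. Then for any complex sequence (b_k)_{k ∈ ℤ} satisfying |b_k| ≪ min( (log 2H)/H , 1/|k| , H/k² ) for k ≠ 0 and |b_0| ≪ (log 2H)/H, one has Σ_{d ≤ D, gcd(d,a)=1} | Σ_{N < n ≤ 2N, n ≡ a (mod d)} Λ(n) Σ_{k ∈ ℤ} b_k e(k n^γ) | ≪ X^γ / (log X)^A. -/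

import Mathlib

/-- `e(t) = exp(2πit)`. -/
noncomputable def e (t : ℝ) : ℂ := Complex.exp (2 * Real.pi * Complex.I * t)

namespace PS
open Finset

lemma e_def' (t : ℝ) : e t = Complex.exp ((2 * Real.pi * t : ℝ) * Complex.I) := by
  unfold e; congr 1; push_cast; ring

lemma norm_e (t : ℝ) : ‖e t‖ = 1 := by
  rw [e_def', Complex.norm_exp_ofReal_mul_I]

lemma e_add (s t : ℝ) : e (s + t) = e s * e t := by
  unfold e; rw [← Complex.exp_add]; congr 1; push_cast; ring

lemma e_neg (t : ℝ) : e (-t) = (starRingEnd ℂ) (e t) := by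
  rw [e_def', e_def', ← Complex.exp_conj]; congr 1
  rw [map_mul, Complex.conj_ofReal, Complex.conj_I]; push_cast; ring

lemma e_sub (s t : ℝ) : e (s - t) = e s * (starRingEnd ℂ) (e t) := by
  rw [sub_eq_add_neg, e_add, e_neg]

lemma e_int (n : ℤ) : e n = 1 := by
  unfold e; rw [Complex.exp_eq_one_iff]; exact ⟨n, by push_cast; ring⟩

lemma norm_sum_e_neg {ι : Type*} (s : Finset ι) (f : ι → ℝ) :
    ‖∑ i ∈ s, e (-(f i))‖ = ‖∑ i ∈ s, e (f i)‖ := by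
  simp_rw [e_neg]; rw [← map_sum, RCLike.norm_conj]

/-- `w(x) = 1/2 + (i/2) cot(π x)`. -/
noncomputable def w (x : ℝ) : ℂ :=
  1 / 2 + Complex.I * ((Real.cos (Real.pi * x) / Real.sin (Real.pi * x) / 2 : ℝ) : ℂ)

lemma w_mul (x : ℝ) (hx : Real.sin (Real.pi * x) ≠ 0) : w x * (1 - e x) = 1 := by
  have h : e x = ((Real.cos (Real.pi * x) ^ 2 - Real.sin (Real.pi * x) ^ 2 : ℝ) : ℂ)
      + ((2 * Real.sin (Real.pi * x) * Real.cos (Real.pi * x) : ℝ) : ℂ) * Complex.I := by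
    rw [e_def', Complex.exp_mul_I, ← Complex.ofReal_cos, ← Complex.ofReal_sin,
      show 2 * Real.pi * x = 2 * (Real.pi * x) by ring, Real.cos_two_mul', Real.sin_two_mul]
  rw [h, w]
  set s := Real.sin (Real.pi * x)
  set c := Real.cos (Real.pi * x)
  have hsc : s ^ 2 + c ^ 2 = 1 := Real.sin_sq_add_cos_sq _
  have hC : (s : ℂ) ^ 2 + (c : ℂ) ^ 2 = 1 := by exact_mod_cast hsc
  have hs' : (s : ℂ) ≠ 0 := by exact_mod_cast hx
  have hI : Complex.I ^ 2 = -1 := Complex.I_sq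
  have h2 : ((s : ℂ) + Complex.I * c) * (1 - (((c:ℂ) ^ 2 - (s:ℂ) ^ 2) + (2 * s * c) * Complex.I))
      = 2 * s := by
    linear_combination (-2 * (s : ℂ) * c ^ 2) * hI + (s - Complex.I * c : ℂ) * hC
  push_cast
  have h3 : (1 / 2 + Complex.I * ((c : ℂ) / s / 2)) = ((s : ℂ) + Complex.I * c) / (2 * s) := by
    field_simp
  rw [h3, div_mul_eq_mul_div, h2, div_self (by simpa using hs')]

lemma sin_lower {x Δ : ℝ} (hΔ : 0 < Δ) (h1 : Δ ≤ x) (h2 : x ≤ 1 - Δ) :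
    2 * Δ ≤ Real.sin (Real.pi * x) := by
  have hpi := Real.pi_pos
  rcases le_total x (1 / 2) with h | h
  · have := Real.mul_le_sin (x := Real.pi * x) (by nlinarith) (by nlinarith)
    have h3 : 2 / Real.pi * (Real.pi * x) = 2 * x := by field_simp
    linarith
  · have := Real.mul_le_sin (x := Real.pi * (1 - x)) (by nlinarith) (by nlinarith)
    have h3 : 2 / Real.pi * (Real.pi * (1 - x)) = 2 * (1 - x) := by field_simp
    have h4 : Real.sin (Real.pi * (1 - x)) = Real.sin (Real.pi * x) := by
      rw [mul_sub, mul_one, Real.sin_pi_sub]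
    linarith

lemma cot_abs {x Δ : ℝ} (hΔ : 0 < Δ) (h1 : Δ ≤ x) (h2 : x ≤ 1 - Δ) :
    |Real.cos (Real.pi * x) / Real.sin (Real.pi * x) / 2| ≤ 1 / (4 * Δ) := by
  have hs := sin_lower hΔ h1 h2
  have hc := Real.abs_cos_le_one (Real.pi * x)
  have hs0 : 0 < Real.sin (Real.pi * x) := by linarith
  rw [abs_div, abs_div, abs_of_pos hs0, abs_of_pos (by norm_num : (0:ℝ) < 2), div_div,
    div_le_div_iff₀ (by positivity) (by positivity)]
  nlinarith

lemma norm_w_le {x Δ : ℝ} (hΔ : 0 < Δ) (h1 : Δ ≤ x) (h2 : x ≤ 1 - Δ) :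
    ‖w x‖ ≤ 1 / 2 + 1 / (4 * Δ) := by
  unfold w
  refine (norm_add_le _ _).trans ?_
  have := cot_abs hΔ h1 h2
  rw [norm_mul, Complex.norm_I, one_mul, Complex.norm_real, Real.norm_eq_abs]
  have : ‖(1 / 2 : ℂ)‖ = 1 / 2 := by simp
  linarith

lemma w_sub_norm {x y : ℝ} (hx : 0 < x) (hy : y < 1) (hxy : x ≤ y) :
    ‖w y - w x‖ = Real.cos (Real.pi * x) / Real.sin (Real.pi * x) / 2
      - Real.cos (Real.pi * y) / Real.sin (Real.pi * y) / 2 := by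
  have hpi := Real.pi_pos
  have hsx : 0 < Real.sin (Real.pi * x) :=
    Real.sin_pos_of_pos_of_lt_pi (by positivity) (by nlinarith)
  have hsy : 0 < Real.sin (Real.pi * y) :=
    Real.sin_pos_of_pos_of_lt_pi (by nlinarith) (by nlinarith)
  have hd : 0 ≤ Real.sin (Real.pi * y - Real.pi * x) :=
    Real.sin_nonneg_of_nonneg_of_le_pi (by nlinarith) (by nlinarith)
  rw [Real.sin_sub] at hd
  have key : 0 ≤ Real.cos (Real.pi * x) / Real.sin (Real.pi * x) / 2
      - Real.cos (Real.pi * y) / Real.sin (Real.pi * y) / 2 := by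
    rw [div_div, div_div, sub_nonneg, div_le_div_iff₀ (by positivity) (by positivity)]
    nlinarith
  have : w y - w x = Complex.I * (-(Real.cos (Real.pi * x) / Real.sin (Real.pi * x) / 2
      - Real.cos (Real.pi * y) / Real.sin (Real.pi * y) / 2) : ℝ) := by
    unfold w; push_cast; ring
  rw [this, norm_mul, Complex.norm_I, one_mul, Complex.norm_real, norm_neg, Real.norm_eq_abs,
    abs_of_nonneg key]

/-- Kusmin–Landau, normalized. -/
lemma kl0 (f : ℕ → ℝ) (Δ : ℝ) (hΔ : 0 < Δ) (n : ℕ)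
    (hm : ∀ j, j + 1 < n → f (j + 1) - f j ≤ f (j + 2) - f (j + 1))
    (h1 : ∀ j < n, Δ ≤ f (j + 1) - f j) (h2 : ∀ j < n, f (j + 1) - f j ≤ 1 - Δ) :
    ‖∑ j ∈ range n, e (f j)‖ ≤ 1 + 1 / Δ := by
  set g : ℕ → ℝ := fun j => f (j + 1) - f j with hg
  set ct : ℕ → ℝ := fun j => Real.cos (Real.pi * g j) / Real.sin (Real.pi * g j) / 2 with hct
  rcases Nat.eq_zero_or_pos n with h0 | hpos
  · subst h0; simp; positivity
  have hterm : ∀ j < n, e (f j) = w (g j) * (e (f j) - e (f (j + 1))) := by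
    intro j hj
    have hs := sin_lower hΔ (h1 j hj) (h2 j hj)
    have hw := w_mul (g j) (by simp only [hg]; linarith)
    have : e (f (j + 1)) = e (f j) * e (g j) := by
      rw [← e_add]; congr 1; simp only [hg]; ring
    rw [this]
    linear_combination (-(e (f j))) * hw
  have claim : ∀ i, i + 1 ≤ n →
      ‖∑ j ∈ range (i + 1), e (f j) + w (g i) * e (f (i + 1))‖ ≤ ‖w (g 0)‖ + (ct 0 - ct i) := by
    intro i
    induction i with
    | zero =>
      intro hi
      rw [sum_range_one]
      have := hterm 0 hi
      have h3 : e (f 0) + w (g 0) * e (f (0 + 1)) = w (g 0) * e (f 0) := by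
        linear_combination this
      rw [h3, norm_mul, norm_e]; simp
    | succ i ih =>
      intro hi
      have ih' := ih (by omega)
      rw [sum_range_succ]
      have ht := hterm (i + 1) (by omega)
      have h3 : ∑ j ∈ range (i + 1), e (f j) + e (f (i + 1)) + w (g (i + 1)) * e (f (i + 1 + 1))
          = (∑ j ∈ range (i + 1), e (f j) + w (g i) * e (f (i + 1)))
            + (w (g (i + 1)) - w (g i)) * e (f (i + 1)) := by
        linear_combination ht
      rw [h3]
      refine (norm_add_le _ _).trans ?_
      rw [norm_mul, norm_e, mul_one, w_sub_norm]
      · simp only [hct] at ih' ⊢; linarith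
      · have := h1 i (by omega); simp only [hg]; linarith
      · have := h2 (i + 1) (by omega); simp only [hg]; linarith
      · exact hm i (by omega)
  obtain ⟨i, rfl⟩ : ∃ i, n = i + 1 := ⟨n - 1, by omega⟩
  have hc := claim i le_rfl
  have a0 := cot_abs hΔ (h1 0 hpos) (h2 0 hpos)
  have ai := cot_abs hΔ (h1 i (by omega)) (h2 i (by omega))
  have w0 := norm_w_le hΔ (h1 0 hpos) (h2 0 hpos)
  have wi := norm_w_le hΔ (h1 i (by omega)) (h2 i (by omega))
  have h4 : ‖∑ j ∈ range (i + 1), e (f j)‖ ≤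
      ‖∑ j ∈ range (i + 1), e (f j) + w (g i) * e (f (i + 1))‖ + ‖w (g i)‖ := by
    have : ∑ j ∈ range (i + 1), e (f j) =
      (∑ j ∈ range (i + 1), e (f j) + w (g i) * e (f (i + 1))) - w (g i) * e (f (i + 1)) := by
        ring
    calc _ = ‖(∑ j ∈ range (i + 1), e (f j) + w (g i) * e (f (i + 1)))
          - w (g i) * e (f (i + 1))‖ := by rw [← this]
      _ ≤ _ := by
        refine (norm_sub_le _ _).trans ?_
        rw [norm_mul, norm_e, mul_one]
  have b0 := (abs_le.mp a0).2
  have bi := (abs_le.mp ai).1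
  have e1 : 1 / Δ = 4 * (1 / (4 * Δ)) := by field_simp
  simp only [hct, hg] at hc
  simp only [hg] at *
  rw [e1]
  linarith

/-- Kusmin–Landau. -/
lemma kl (f : ℕ → ℝ) (ν : ℤ) (Δ : ℝ) (hΔ : 0 < Δ) (u n : ℕ)
    (hm : ∀ j, u ≤ j → j + 1 < u + n → f (j + 1) - f j ≤ f (j + 2) - f (j + 1))
    (h1 : ∀ j, u ≤ j → j < u + n → ν + Δ ≤ f (j + 1) - f j)
    (h2 : ∀ j, u ≤ j → j < u + n → f (j + 1) - f j ≤ ν + 1 - Δ) :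
    ‖∑ j ∈ Ico u (u + n), e (f j)‖ ≤ 1 + 1 / Δ := by
  have := kl0 (fun j => f (u + j) - ((ν * (j : ℤ) : ℤ) : ℝ)) Δ hΔ n ?_ ?_ ?_
  · rw [sum_Ico_eq_sum_range, Nat.add_sub_cancel_left]
    have h : ∀ j, e (f (u + j) - ((ν * (j : ℤ) : ℤ) : ℝ)) = e (f (u + j)) := by
      intro j
      rw [e_sub, e_int]; simp
    simp_rw [h] at this
    exact this
  · intro j hj
    have := hm (u + j) (by omega) (by omega)
    push_cast
    rw [← add_assoc, ← add_assoc]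
    linarith
  · intro j hj
    have := h1 (u + j) (by omega) (by omega)
    push_cast
    rw [← add_assoc]
    linarith
  · intro j hj
    have := h2 (u + j) (by omega) (by omega)
    push_cast
    rw [← add_assoc]
    linarith

end PS

namespace PS
open Finset

lemma card_near (g : ℕ → ℝ) (n : ℕ) (lam D : ℝ) (hl : 0 < lam) (hD : 0 ≤ D)
    (hg : ∀ i j, i ≤ j → j < n → lam * ((j : ℝ) - i) ≤ g j - g i)
    (s : Finset ℕ) (hs : ∀ j ∈ s, j < n) (hd : ∀ i ∈ s, ∀ j ∈ s, g j - g i ≤ D) :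
    (s.card : ℝ) ≤ D / lam + 1 := by
  rcases s.eq_empty_or_nonempty with h | h
  · subst h; simp; positivity
  · set a := s.min' h
    set b := s.max' h
    have hab : a ≤ b := s.min'_le_max' h
    have h1 := hg a b hab (hs b (s.max'_mem h))
    have h2 := hd a (s.min'_mem h) b (s.max'_mem h)
    have h3 : s ⊆ Icc a b := fun j hj => mem_Icc.2 ⟨s.min'_le j hj, s.le_max' j hj⟩
    have h4 := card_le_card h3
    rw [Nat.card_Icc] at h4
    have h5 : (s.card : ℝ) ≤ (b : ℝ) - a + 1 := by
      have : s.card + a ≤ b + 1 := by omega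
      have : ((s.card + a : ℕ) : ℝ) ≤ ((b + 1 : ℕ) : ℝ) := by exact_mod_cast this
      push_cast at this; linarith
    have h6 : (b : ℝ) - a ≤ D / lam := by
      rw [le_div_iff₀ hl]; linarith
    linarith

lemma norm_sum_le_card (s : Finset ℕ) (f : ℕ → ℝ) : ‖∑ j ∈ s, e (f j)‖ ≤ s.card := by
  refine (norm_sum_le _ _).trans ?_
  simp [norm_e]

/-- Discrete second derivative test. -/
lemma second_test (f : ℕ → ℝ) (J : ℕ) (lam C : ℝ) (hl : 0 < lam) (hC : 1 ≤ C)
    (h1 : ∀ j, j + 2 < J → lam ≤ f (j + 2) - 2 * f (j + 1) + f j)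
    (h2 : ∀ j, j + 2 < J → f (j + 2) - 2 * f (j + 1) + f j ≤ C * lam) :
    ‖∑ j ∈ range J, e (f j)‖ ≤ 10 * (C * √lam * J + 1 / √lam) := by
  have hsq : 0 < √lam := Real.sqrt_pos.2 hl
  have hss : √lam * √lam = lam := Real.mul_self_sqrt hl.le
  have htriv := norm_sum_le_card (range J) f
  rw [card_range] at htriv
  have hJ0 : (0 : ℝ) ≤ J := Nat.cast_nonneg _
  rcases le_or_gt (1 / 2) √lam with hbig | hsmall
  · have h3 : (J : ℝ) ≤ 2 * (√lam * J) := by nlinarith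
    have h4 : √lam * J ≤ C * √lam * J := by
      have : 0 ≤ √lam * J := by positivity
      nlinarith
    have : 0 < 1 / √lam := by positivity
    nlinarith
  have hinv : 2 ≤ 1 / √lam := by rw [le_div_iff₀ hsq]; linarith
  have hpos1 : 0 ≤ C * √lam * J := by positivity
  rcases Nat.lt_or_ge J 2 with hJ | hJ
  · have : (J : ℝ) ≤ 1 := by exact_mod_cast (by omega : J ≤ 1)
    nlinarith
  obtain ⟨n, rfl⟩ : ∃ n, J = n + 1 := ⟨J - 1, by omega⟩
  have hn : 1 ≤ n := by omega
  set g : ℕ → ℝ := fun j => f (j + 1) - f j with hgdef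
  have hstep1 : ∀ j, j + 1 < n → lam ≤ g (j + 1) - g j := by
    intro j hj
    have := h1 j (by omega)
    simp only [hgdef]; linarith
  have hstep2 : ∀ j, j + 1 < n → g (j + 1) - g j ≤ C * lam := by
    intro j hj
    have := h2 j (by omega)
    simp only [hgdef]; linarith
  have hlow : ∀ i j, i ≤ j → j < n → lam * ((j : ℝ) - i) ≤ g j - g i := by
    intro i j hij
    induction j, hij using Nat.le_induction with
    | base => intro _; simp
    | succ j hij ih =>
      intro hj
      have := ih (by omega)
      have := hstep1 j hj
      push_cast; linarith
  have hupp : ∀ i j, i ≤ j → j < n → g j - g i ≤ C * lam * ((j : ℝ) - i) := by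
    intro i j hij
    induction j, hij using Nat.le_induction with
    | base => intro _; simp
    | succ j hij ih =>
      intro hj
      have := ih (by omega)
      have := hstep2 j hj
      push_cast; linarith
  have hmono : ∀ i j, i ≤ j → j < n → g i ≤ g j := by
    intro i j hij hj
    have := hlow i j hij hj
    have h : (i : ℝ) ≤ j := by exact_mod_cast hij
    nlinarith
  set Δ := √lam with hΔ
  have hΔl : Δ / lam = 1 / Δ := by
    rw [← hss]; field_simp
  -- each fibre
  have hfib : ∀ ν : ℤ, ‖∑ j ∈ (range n).filter (fun j => ⌊g j⌋ = ν), e (f j)‖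
      ≤ (1 + 1 / Δ) + 2 * (1 / Δ + 1) := by
    intro ν
    set F := (range n).filter (fun j => ⌊g j⌋ = ν) with hF
    have hFm : ∀ j ∈ F, j < n ∧ (ν : ℝ) ≤ g j ∧ g j < ν + 1 := by
      intro j hj
      rw [hF, mem_filter, mem_range, Int.floor_eq_iff] at hj
      exact hj
    rw [← sum_filter_add_sum_filter_not F (fun j => ν + Δ ≤ g j ∧ g j ≤ ν + 1 - Δ)]
    refine (norm_add_le _ _).trans (add_le_add ?_ ?_)
    · set s := F.filter (fun j => ν + Δ ≤ g j ∧ g j ≤ ν + 1 - Δ) with hs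
      have hsm : ∀ j ∈ s, j < n ∧ ν + Δ ≤ g j ∧ g j ≤ ν + 1 - Δ := by
        intro j hj
        rw [hs, mem_filter] at hj
        exact ⟨(hFm j hj.1).1, hj.2⟩
      rcases s.eq_empty_or_nonempty with h | h
      · rw [h]; simp; positivity
      · set a := s.min' h
        set b := s.max' h
        have hab : a ≤ b := s.min'_le_max' h
        obtain ⟨ha0, ha1, ha2⟩ := hsm a (s.min'_mem h)
        obtain ⟨hb0, hb1, hb2⟩ := hsm b (s.max'_mem h)
        have hin : ∀ j, a ≤ j → j ≤ b → ν + Δ ≤ g j ∧ g j ≤ ν + 1 - Δ := by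
          intro j h3 h4
          have := hmono a j h3 (by omega)
          have := hmono j b h4 (by omega)
          constructor <;> linarith
        have hse : s = Ico a (a + (b - a + 1)) := by
          ext j
          rw [mem_Ico]
          constructor
          · intro hj
            have := s.min'_le j hj
            have := s.le_max' j hj
            omega
          · rintro ⟨h3, h4⟩
            have h5 := hin j h3 (by omega)
            rw [hs, mem_filter, hF, mem_filter, mem_range, Int.floor_eq_iff]
            refine ⟨⟨by omega, by linarith, by linarith⟩, h5⟩
        rw [hse]
        apply kl f ν Δ hsq
        · intro j h3 h4
          exact hmono j (j + 1) (by omega) (by omega)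
        · intro j h3 h4
          exact (hin j h3 (by omega)).1
        · intro j h3 h4
          exact (hin j h3 (by omega)).2
    · set s1 := (range n).filter (fun j => (ν : ℝ) ≤ g j ∧ g j ≤ ν + Δ)
      set s2 := (range n).filter (fun j => (ν : ℝ) + 1 - Δ ≤ g j ∧ g j ≤ ν + 1)
      have c1 := card_near g n lam Δ hl hsq.le hlow s1
        (fun j hj => mem_range.1 (mem_filter.1 hj).1) (by
          intro i hi j hj
          have h3 := (mem_filter.1 hi).2
          have h4 := (mem_filter.1 hj).2
          linarith [h3.1, h4.2])
      have c2 := card_near g n lam Δ hl hsq.le hlow s2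
        (fun j hj => mem_range.1 (mem_filter.1 hj).1) (by
          intro i hi j hj
          have h3 := (mem_filter.1 hi).2
          have h4 := (mem_filter.1 hj).2
          linarith [h3.1, h4.2])
      refine (norm_sum_le_card _ _).trans ?_
      have hsub : F.filter (fun j => ¬ (ν + Δ ≤ g j ∧ g j ≤ ν + 1 - Δ)) ⊆ s1 ∪ s2 := by
        intro j hj
        rw [mem_filter] at hj
        obtain ⟨h3, h4, h5⟩ := hFm j hj.1
        rw [mem_union, mem_filter, mem_filter, mem_range]
        by_cases h6 : ν + Δ ≤ g j
        · right
          refine ⟨h3, ?_, h5.le⟩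
          by_contra h7
          exact hj.2 ⟨h6, by linarith⟩
        · left
          exact ⟨h3, h4, by linarith⟩
      have h7 := (card_le_card hsub).trans (card_union_le _ _)
      have h8 : ((F.filter (fun j => ¬ (ν + Δ ≤ g j ∧ g j ≤ ν + 1 - Δ))).card : ℝ)
          ≤ s1.card + s2.card := by exact_mod_cast h7
      rw [hΔl] at c1 c2
      linarith
  have hmaps : ∀ j ∈ range n, ⌊g j⌋ ∈ Icc ⌊g 0⌋ ⌊g (n - 1)⌋ := by
    intro j hj
    rw [mem_range] at hj
    rw [mem_Icc]
    exact ⟨Int.floor_le_floor (hmono 0 j (by omega) hj),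
      Int.floor_le_floor (hmono j (n - 1) (by omega) (by omega))⟩
  have hcard : ((Icc ⌊g 0⌋ ⌊g (n - 1)⌋).card : ℝ) ≤ C * lam * n + 2 := by
    rw [Int.card_Icc]
    have h3 := Int.floor_le_floor (hmono 0 (n - 1) (by omega) (by omega))
    have h4 : (((⌊g (n - 1)⌋ + 1 - ⌊g 0⌋).toNat : ℕ) : ℝ) = ⌊g (n - 1)⌋ + 1 - ⌊g 0⌋ := by
      have : (((⌊g (n - 1)⌋ + 1 - ⌊g 0⌋).toNat : ℤ)) = ⌊g (n - 1)⌋ + 1 - ⌊g 0⌋ :=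
        Int.toNat_of_nonneg (by omega)
      exact_mod_cast congrArg (fun z : ℤ => (z : ℝ)) this
    rw [h4]
    have h5 := Int.floor_le (g (n - 1))
    have h6 := Int.lt_floor_add_one (g 0)
    have h7 := hupp 0 (n - 1) (by omega) (by omega)
    have h8 : ((n - 1 : ℕ) : ℝ) ≤ n := by exact_mod_cast Nat.sub_le _ _
    have h9 : 0 ≤ C * lam := by positivity
    have h10 := mul_le_mul_of_nonneg_left h8 h9
    push_cast at h7
    simp only [sub_zero, CharP.cast_eq_zero] at h7
    push_cast at h10
    linarith
  have hmain : ‖∑ j ∈ range n, e (f j)‖ ≤ (C * lam * n + 2) * (3 + 3 * (1 / Δ)) := by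
    rw [← sum_fiberwise_of_maps_to hmaps]
    refine (norm_sum_le _ _).trans ?_
    refine (sum_le_sum (fun ν _ => hfib ν)).trans ?_
    rw [sum_const, nsmul_eq_mul]
    have : (1 + 1 / Δ) + 2 * (1 / Δ + 1) = 3 + 3 * (1 / Δ) := by ring
    rw [this]
    exact mul_le_mul_of_nonneg_right hcard (by positivity)
  rw [sum_range_succ]
  refine (norm_add_le _ _).trans ?_
  rw [norm_e]
  have hn' : (0 : ℝ) ≤ n := Nat.cast_nonneg _
  have hA : (C * lam * n + 2) * (3 + 3 * (1 / Δ)) ≤ (C * lam * n + 2) * (9 / 2 * (1 / Δ)) := by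
    apply mul_le_mul_of_nonneg_left _ (by positivity)
    linarith
  have hB : (C * lam * n + 2) * (9 / 2 * (1 / Δ)) = 9 / 2 * (C * Δ * n) + 9 * (1 / Δ) := by
    rw [← hss]; field_simp
  push_cast
  have : 0 ≤ C * Δ * n := by positivity
  have : 0 ≤ C * Δ := by positivity
  linarith

end PS

namespace PS
open Finset

/-- shifted, zero-extended sequence -/
noncomputable def Zs (f : ℕ → ℝ) (J h r : ℕ) : ℂ :=
  if r ≤ h ∧ h < J + r then e (f (h - r)) else 0

lemma sum_Zs (f : ℕ → ℝ) (J R r : ℕ) (hr : r < R) :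
    ∑ h ∈ range (J + R), Zs f J h r = ∑ j ∈ range J, e (f j) := by
  unfold Zs
  rw [← sum_filter]
  have : (range (J + R)).filter (fun h => r ≤ h ∧ h < J + r) = Ico r (J + r) := by
    ext h; simp only [mem_filter, mem_range, mem_Ico]; omega
  rw [this, sum_Ico_eq_sum_range]
  simp

lemma corr_Zs (f : ℕ → ℝ) (J R r s : ℕ) (hr : r < R) (hs : s < r) :
    ‖∑ h ∈ range (J + R), Zs f J h r * (starRingEnd ℂ) (Zs f J h s)‖
      = ‖∑ n ∈ range (J - (r - s)), e (f (n + (r - s)) - f n)‖ := by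
  have h1 : ∀ h, Zs f J h r * (starRingEnd ℂ) (Zs f J h s) =
      if r ≤ h ∧ h < J + s then e (f (h - r)) * (starRingEnd ℂ) (e (f (h - s))) else 0 := by
    intro h
    unfold Zs
    by_cases ha : r ≤ h ∧ h < J + s
    · rw [if_pos ha, if_pos ⟨ha.1, by omega⟩, if_pos ⟨by omega, ha.2⟩]
    · rw [if_neg ha]
      by_cases hb : r ≤ h ∧ h < J + r
      · rw [if_neg (c := s ≤ h ∧ h < J + s) (by omega)]; simp
      · rw [if_neg hb]; simp
  simp_rw [h1]
  rw [← sum_filter]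
  have : (range (J + R)).filter (fun h => r ≤ h ∧ h < J + s) = Ico r (J + s) := by
    ext h; simp only [mem_filter, mem_range, mem_Ico]; omega
  rw [this, sum_Ico_eq_sum_range, show J + s - r = J - (r - s) by omega,
    ← norm_sum_e_neg]
  congr 1
  apply sum_congr rfl
  intro n _
  rw [neg_sub, e_sub, show r + n - r = n by omega, show r + n - s = n + (r - s) by omega]

/-- van der Corput inequality -/
lemma vdc (f : ℕ → ℝ) (J R : ℕ) (B : ℝ) (hR : 1 ≤ R) (hB : 0 ≤ B)
    (h : ∀ t, 1 ≤ t → t < R → ‖∑ n ∈ range (J - t), e (f (n + t) - f n)‖ ≤ B) :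
    ‖∑ j ∈ range J, e (f j)‖ ^ 2 ≤ ((J : ℝ) + R) * (J / R + B) := by
  set S := ∑ j ∈ range J, e (f j) with hS
  have hRp : (0 : ℝ) < R := by exact_mod_cast hR
  have e1 : (R : ℂ) * S = ∑ h ∈ range (J + R), ∑ r ∈ range R, Zs f J h r := by
    rw [sum_comm, sum_congr rfl (fun r hr => sum_Zs f J R r (mem_range.1 hr)), sum_const,
      card_range, nsmul_eq_mul]
  have e2 : ((R : ℝ) * ‖S‖) ^ 2 ≤
      ((J : ℝ) + R) * ∑ h ∈ range (J + R), ‖∑ r ∈ range R, Zs f J h r‖ ^ 2 := by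
    have : (R : ℝ) * ‖S‖ = ‖(R : ℂ) * S‖ := by simp
    rw [this, e1]
    calc _ ≤ (∑ h ∈ range (J + R), ‖∑ r ∈ range R, Zs f J h r‖) ^ 2 := by
          gcongr; exact norm_sum_le _ _
      _ ≤ _ := by
          have := sq_sum_le_card_mul_sum_sq (s := range (J + R))
            (f := fun h => ‖∑ r ∈ range R, Zs f J h r‖)
          rw [card_range] at this
          push_cast at this
          exact this
  have e3 : ((∑ h ∈ range (J + R), ‖∑ r ∈ range R, Zs f J h r‖ ^ 2 : ℝ) : ℂ)
      = ∑ r ∈ range R, ∑ s ∈ range R, ∑ h ∈ range (J + R),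
        Zs f J h r * (starRingEnd ℂ) (Zs f J h s) := by
    push_cast
    have : ∀ h, ((‖∑ r ∈ range R, Zs f J h r‖ : ℂ)) ^ 2 =
        ∑ r ∈ range R, ∑ s ∈ range R, Zs f J h r * (starRingEnd ℂ) (Zs f J h s) := by
      intro h
      rw [← Complex.mul_conj', map_sum, sum_mul_sum]
    simp_rw [this]
    rw [sum_comm]
    apply sum_congr rfl
    intro r _
    rw [sum_comm]
  have hbd : ∀ r ∈ range R, ∀ s ∈ range R,
      ‖∑ h ∈ range (J + R), Zs f J h r * (starRingEnd ℂ) (Zs f J h s)‖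
        ≤ (if r = s then (J : ℝ) else 0) + B := by
    intro r hr s hs
    rw [mem_range] at hr hs
    rcases lt_trichotomy r s with h1 | h1 | h1
    · rw [if_neg (by omega), zero_add]
      have : ‖∑ h ∈ range (J + R), Zs f J h r * (starRingEnd ℂ) (Zs f J h s)‖ =
          ‖∑ h ∈ range (J + R), Zs f J h s * (starRingEnd ℂ) (Zs f J h r)‖ := by
        rw [← RCLike.norm_conj, map_sum]
        congr 1
        apply sum_congr rfl
        intro h _
        rw [map_mul, RCLike.conj_conj, mul_comm]
      rw [this, corr_Zs f J R s r hs h1]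
      exact h _ (by omega) (by omega)
    · subst h1
      rw [if_pos rfl]
      have h2 : ‖∑ h ∈ range (J + R), Zs f J h r * (starRingEnd ℂ) (Zs f J h r)‖ ≤ J := by
        refine (norm_sum_le _ _).trans ?_
        have h3 : ∀ h, ‖Zs f J h r * (starRingEnd ℂ) (Zs f J h r)‖ =
            if r ≤ h ∧ h < J + r then (1 : ℝ) else 0 := by
          intro h
          unfold Zs
          split_ifs <;> simp [norm_e]
        simp_rw [h3]
        rw [← sum_filter, sum_const, nsmul_eq_mul, mul_one]
        have : (range (J + R)).filter (fun h => r ≤ h ∧ h < J + r) = Ico r (J + r) := by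
          ext h; simp only [mem_filter, mem_range, mem_Ico]; omega
        rw [this]; simp
      linarith
    · rw [if_neg (by omega), zero_add, corr_Zs f J R r s hr h1]
      exact h _ (by omega) (by omega)
  have e4 : ∑ h ∈ range (J + R), ‖∑ r ∈ range R, Zs f J h r‖ ^ 2 ≤ R * J + R ^ 2 * B := by
    have h0 : 0 ≤ ∑ h ∈ range (J + R), ‖∑ r ∈ range R, Zs f J h r‖ ^ 2 := by positivity
    have : ∑ h ∈ range (J + R), ‖∑ r ∈ range R, Zs f J h r‖ ^ 2 =
        ‖((∑ h ∈ range (J + R), ‖∑ r ∈ range R, Zs f J h r‖ ^ 2 : ℝ) : ℂ)‖ := by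
      rw [Complex.norm_real, Real.norm_of_nonneg h0]
    rw [this, e3]
    refine (norm_sum_le _ _).trans ?_
    calc _ ≤ ∑ r ∈ range R, ∑ s ∈ range R, ((if r = s then (J : ℝ) else 0) + B) := by
          apply sum_le_sum; intro r hr
          refine (norm_sum_le _ _).trans ?_
          exact sum_le_sum (hbd r hr)
      _ = ∑ r ∈ range R, ((J : ℝ) + R * B) := by
          apply sum_congr rfl; intro r hr
          rw [sum_add_distrib, sum_ite_eq, if_pos hr]; simp
      _ = _ := by rw [sum_const, card_range, nsmul_eq_mul]; ring
  have e5 : ((R : ℝ) * ‖S‖) ^ 2 ≤ ((J : ℝ) + R) * (R * J + R ^ 2 * B) :=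
    e2.trans (by gcongr)
  have e6 : ((J : ℝ) + R) * (R * J + R ^ 2 * B) = R ^ 2 * (((J : ℝ) + R) * (J / R + B)) := by
    field_simp
  rw [e6, mul_pow] at e5
  exact le_of_mul_le_mul_left e5 (by positivity)

/-- Discrete third derivative test. -/
lemma third_test (f : ℕ → ℝ) (J R : ℕ) (lam C : ℝ) (hl : 0 < lam) (hC : 1 ≤ C) (hR : 1 ≤ R)
    (h1 : ∀ j, j + 3 < J → lam ≤ f (j + 3) - 3 * f (j + 2) + 3 * f (j + 1) - f j)
    (h2 : ∀ j, j + 3 < J → f (j + 3) - 3 * f (j + 2) + 3 * f (j + 1) - f j ≤ C * lam) :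
    ‖∑ j ∈ range J, e (f j)‖ ^ 2 ≤
      ((J : ℝ) + R) * (J / R + 10 * (C * √(R * lam) * J + 1 / √lam)) := by
  apply vdc f J R _ hR (by positivity)
  intro t ht htR
  have htp : (1 : ℝ) ≤ t := by exact_mod_cast ht
  have hd : ∀ t j, j + 2 + t < J → t * lam ≤ (f (j + 2 + t) - f (j + 2))
      - 2 * (f (j + 1 + t) - f (j + 1)) + (f (j + t) - f j) ∧
      (f (j + 2 + t) - f (j + 2))
      - 2 * (f (j + 1 + t) - f (j + 1)) + (f (j + t) - f j) ≤ C * (t * lam) := by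
    intro t
    induction t with
    | zero => intro j _; simp
    | succ t ih =>
      intro j hj
      have a1 := ih j (by omega)
      have a2 := h1 (j + t) (by omega)
      have a3 := h2 (j + t) (by omega)
      rw [show j + 2 + (t + 1) = j + t + 3 by ring, show j + 1 + (t + 1) = j + t + 2 by ring,
        show j + (t + 1) = j + t + 1 by ring]
      rw [show j + 2 + t = j + t + 2 by ring, show j + 1 + t = j + t + 1 by ring] at a1
      push_cast
      constructor <;> linarith [a1.1, a1.2]
  have := second_test (fun n => f (n + t) - f n) (J - t) (t * lam) C (by positivity) hC
    (fun j hj => by have := (hd t j (by omega)).1; simpa using this)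
    (fun j hj => by have := (hd t j (by omega)).2; simpa using this)
  refine this.trans ?_
  have hJ : ((J - t : ℕ) : ℝ) ≤ J := by exact_mod_cast Nat.sub_le _ _
  have htR' : (t : ℝ) ≤ R := by exact_mod_cast htR.le
  have s1 : √(t * lam) ≤ √(R * lam) := Real.sqrt_le_sqrt (by gcongr)
  have s2 : √lam ≤ √(t * lam) := Real.sqrt_le_sqrt (by nlinarith)
  have : 0 < √lam := Real.sqrt_pos.2 hl
  gcongr

end PS

namespace PS
open Finset

lemma mvt (f f' : ℝ → ℝ) (a d : ℝ) (hd : 0 < d)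
    (h : ∀ y, a ≤ y → y ≤ a + d → HasDerivAt f (f' y) y) :
    ∃ ξ, a < ξ ∧ ξ < a + d ∧ f (a + d) - f a = d * f' ξ := by
  obtain ⟨ξ, hξ, h2⟩ := exists_hasDerivAt_eq_slope f f' (show a < a + d by linarith)
    (fun y hy => (h y hy.1 hy.2).continuousAt.continuousWithinAt)
    (fun y hy => h y hy.1.le hy.2.le)
  refine ⟨ξ, hξ.1, hξ.2, ?_⟩
  rw [h2, add_sub_cancel_left]; field_simp

lemma hd_pow (p s x : ℝ) (hx : 0 < x + s) :
    HasDerivAt (fun y : ℝ => (y + s) ^ p) (p * (x + s) ^ (p - 1)) x := by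
  have := (Real.hasDerivAt_rpow_const (x := x + s) (p := p) (Or.inl hx.ne')).comp x
    ((hasDerivAt_id x).add_const s)
  simpa [Function.comp_def] using this

lemma diff1 (p x d : ℝ) (hx : 0 < x) (hd : 0 < d) :
    ∃ ξ, x < ξ ∧ ξ < x + d ∧ (x + d) ^ p - x ^ p = d * (p * ξ ^ (p - 1)) :=
  mvt (fun y => y ^ p) (fun y => p * y ^ (p - 1)) x d hd (fun y hy _ => by
    have := hd_pow p 0 y (by linarith)
    simpa using this)

lemma diff2 (p x d : ℝ) (hx : 0 < x) (hd : 0 < d) :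
    ∃ ξ, x < ξ ∧ ξ < x + 2 * d ∧ (x + 2 * d) ^ p - 2 * (x + d) ^ p + x ^ p
      = d ^ 2 * (p * (p - 1) * ξ ^ (p - 2)) := by
  obtain ⟨η, h1, h2, h3⟩ := mvt (fun y => (y + d) ^ p - (y + 0) ^ p)
    (fun y => p * (y + d) ^ (p - 1) - p * (y + 0) ^ (p - 1)) x d hd (fun y hy _ =>
      (hd_pow p d y (by linarith)).sub (hd_pow p 0 y (by linarith)))
  obtain ⟨ξ, g1, g2, g3⟩ := diff1 (p - 1) η d (by linarith) hd
  refine ⟨ξ, by linarith, by linarith, ?_⟩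
  simp only [add_zero] at h3
  rw [show x + d + d = x + 2 * d by ring] at h3
  rw [show p - 1 - 1 = p - 2 by ring] at g3
  linear_combination h3 + d * p * g3

lemma diff3 (p x d : ℝ) (hx : 0 < x) (hd : 0 < d) :
    ∃ ξ, x < ξ ∧ ξ < x + 3 * d ∧
      (x + 3 * d) ^ p - 3 * (x + 2 * d) ^ p + 3 * (x + d) ^ p - x ^ p
      = d ^ 3 * (p * (p - 1) * (p - 2) * ξ ^ (p - 3)) := by
  obtain ⟨η, h1, h2, h3⟩ := mvt (fun y => (y + 2 * d) ^ p - 2 * (y + d) ^ p + (y + 0) ^ p)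
    (fun y => p * (y + 2 * d) ^ (p - 1) - 2 * (p * (y + d) ^ (p - 1)) + p * (y + 0) ^ (p - 1))
    x d hd (fun y hy _ =>
      ((hd_pow p (2 * d) y (by linarith)).sub ((hd_pow p d y (by linarith)).const_mul 2)).add
        (hd_pow p 0 y (by linarith)))
  obtain ⟨ξ, g1, g2, g3⟩ := diff2 (p - 1) η d (by linarith) hd
  refine ⟨ξ, by linarith, by linarith, ?_⟩
  simp only [add_zero] at h3
  rw [show x + d + 2 * d = x + 3 * d by ring, show x + d + d = x + 2 * d by ring] at h3
  rw [show p - 1 - 2 = p - 3 by ring, show p - 1 - 1 = p - 2 by ring] at g3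
  linear_combination h3 + d * p * g3

lemma pow_range (q : ℝ) (k : ℕ) (hq : q ≤ 0) (hk : -(k : ℝ) ≤ q) (M ξ : ℝ) (hM : 0 < M)
    (h1 : M ≤ ξ) (h2 : ξ ≤ 4 * M) : M ^ q / 4 ^ k ≤ ξ ^ q ∧ ξ ^ q ≤ M ^ q := by
  constructor
  · have h3 : (4 * M) ^ q ≤ ξ ^ q := Real.rpow_le_rpow_of_nonpos (by linarith) h2 hq
    rw [Real.mul_rpow (by norm_num) hM.le] at h3
    have h4 : (4 : ℝ) ^ (-(k : ℝ)) ≤ 4 ^ q := Real.rpow_le_rpow_of_exponent_le (by norm_num) hk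
    rw [Real.rpow_neg (by norm_num), Real.rpow_natCast] at h4
    have h5 : 0 < M ^ q := Real.rpow_pos_of_pos hM q
    rw [div_eq_inv_mul]
    exact (mul_le_mul_of_nonneg_right h4 h5.le).trans h3
  · exact Real.rpow_le_rpow_of_nonpos hM h1 hq

set_option maxHeartbeats 1600000 in
/-- Exponential sum over an arithmetic progression. -/
lemma expSum_pos (γ : ℝ) (h0 : 0 < γ) (hγ1 : γ < 1) :
    ∃ C : ℝ, 1 ≤ C ∧ ∀ (c M d P m0 : ℝ) (n : ℕ), 0 < c → 0 < M → 0 < d → 1 ≤ P →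
      (∀ j < n, M ≤ m0 + d * j ∧ m0 + d * j ≤ 4 * M) →
      P ^ 2 ≤ c * M ^ γ → c * M ^ γ * P ^ 6 ≤ (M / d) ^ 3 → P ^ 6 ≤ M / d →
      ‖∑ j ∈ range n, e (c * (m0 + d * j) ^ γ)‖ ≤ C * (M / d / P) := by
  set k2 := √(γ * (1 - γ) / 16) with hk2
  set k3 := √(γ * (1 - γ) * (2 - γ) / 64) with hk3
  have p2 : 0 < γ * (1 - γ) / 16 := by
    have : 0 < 1 - γ := by linarith
    positivity
  have p3 : 0 < γ * (1 - γ) * (2 - γ) / 64 := by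
    have : 0 < 1 - γ := by linarith
    have : 0 < 2 - γ := by linarith
    positivity
  have k2p : 0 < k2 := Real.sqrt_pos.2 p2
  have k3p : 0 < k3 := Real.sqrt_pos.2 p3
  have k2s : k2 ^ 2 = γ * (1 - γ) / 16 := Real.sq_sqrt p2.le
  have k3s : k3 ^ 2 = γ * (1 - γ) * (2 - γ) / 64 := Real.sq_sqrt p3.le
  have k21 : k2 ≤ 1 := by
    by_contra! h; nlinarith
  have k31 : k3 ≤ 1 := by
    have : γ * (1 - γ) ≤ 1 := by nlinarith
    have : γ * (1 - γ) * (2 - γ) ≤ 2 := by nlinarith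
    by_contra! h; nlinarith
  have k2i : 1 ≤ 1 / k2 := by rw [le_div_iff₀ k2p]; linarith
  have k3i : 1 ≤ 1 / k3 := by rw [le_div_iff₀ k3p]; linarith
  refine ⟨650 * (1 / k2) + 200 * (1 / k3), by linarith, ?_⟩
  intro c M d P m0 n hc hM hd hP hr hT1 hT2 hJP
  set T := c * M ^ γ with hT
  set J := M / d with hJ
  have hP0 : 0 < P := by linarith
  have hJp : 0 < J := by positivity
  have hTp : 0 < T := lt_of_lt_of_le (by positivity) hT1
  have hP6 : 1 ≤ P ^ 6 := one_le_pow₀ hP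
  have hJ1 : 1 ≤ J := hP6.trans hJP
  have hn : (n : ℝ) ≤ 4 * J := by
    rcases Nat.eq_zero_or_pos n with h | h
    · subst h; simp; positivity
    · have a1 := (hr 0 h).1
      have a2 := (hr (n - 1) (by omega)).2
      have a3 : ((n - 1 : ℕ) : ℝ) = n - 1 := by rw [Nat.cast_sub h]; simp
      rw [a3] at a2
      simp only [Nat.cast_zero, mul_zero, add_zero] at a1
      have a4 : ((n : ℝ) - 1) ≤ 3 * J := by
        rw [hJ, ← mul_div_assoc, le_div_iff₀ hd]; linarith
      linarith
  have hTJ2 : T / J ^ 2 = c * d ^ 2 * M ^ (γ - 2) := by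
    rw [hT, hJ, Real.rpow_sub hM, show (2 : ℝ) = ((2 : ℕ) : ℝ) by norm_num, Real.rpow_natCast]
    field_simp
  have hTJ3 : T / J ^ 3 = c * d ^ 3 * M ^ (γ - 3) := by
    rw [hT, hJ, Real.rpow_sub hM, show (3 : ℝ) = ((3 : ℕ) : ℝ) by norm_num, Real.rpow_natCast]
    field_simp
  have hn0 : (0 : ℝ) ≤ n := Nat.cast_nonneg _
  rcases le_or_gt (T * P ^ 2) (J ^ 2) with hA | hB
  · -- second derivative test
    have hl : 0 < k2 ^ 2 * (T / J ^ 2) := by positivity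
    have key : ∀ j : ℕ, j + 2 < n → ∃ ξ, M ≤ ξ ∧ ξ ≤ 4 * M ∧
        -(c * (m0 + d * (j + 2 : ℕ)) ^ γ) - 2 * -(c * (m0 + d * (j + 1 : ℕ)) ^ γ)
          + -(c * (m0 + d * (j : ℕ)) ^ γ) = c * d ^ 2 * (γ * (1 - γ)) * ξ ^ (γ - 2) := by
      intro j hj
      have b1 := (hr j (by omega)).1
      have b2 := (hr (j + 2) hj).2
      obtain ⟨ξ, g1, g2, g3⟩ := diff2 γ (m0 + d * j) d (by linarith) hd
      push_cast at b2
      refine ⟨ξ, by linarith, by linarith, ?_⟩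
      push_cast
      rw [show m0 + d * ((j : ℝ) + 2) = m0 + d * j + 2 * d by ring,
        show m0 + d * ((j : ℝ) + 1) = m0 + d * j + d by ring]
      linear_combination (-c) * g3
    have h16 : (4 : ℝ) ^ 2 = 16 := by norm_num
    have hst := second_test (fun j : ℕ => -(c * (m0 + d * j) ^ γ)) n (k2 ^ 2 * (T / J ^ 2)) 16 hl
      (by norm_num) (by
        intro j hj
        obtain ⟨ξ, g1, g2, g3⟩ := key j hj
        have hp := (pow_range (γ - 2) 2 (by linarith) (by push_cast; linarith) M ξ hM g1 g2).1
        rw [g3, k2s, hTJ2]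
        have hcc : 0 < c * d ^ 2 * (γ * (1 - γ)) := by
          have : 0 < γ * (1 - γ) := by linarith
          positivity
        calc _ = c * d ^ 2 * (γ * (1 - γ)) * (M ^ (γ - 2) / 4 ^ 2) := by rw [h16]; ring
          _ ≤ _ := mul_le_mul_of_nonneg_left hp hcc.le) (by
        intro j hj
        obtain ⟨ξ, g1, g2, g3⟩ := key j hj
        have hp := (pow_range (γ - 2) 2 (by linarith) (by push_cast; linarith) M ξ hM g1 g2).2
        rw [g3, k2s, hTJ2]
        have hcc : 0 < c * d ^ 2 * (γ * (1 - γ)) := by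
          have : 0 < γ * (1 - γ) := by linarith
          positivity
        calc _ ≤ c * d ^ 2 * (γ * (1 - γ)) * M ^ (γ - 2) := mul_le_mul_of_nonneg_left hp hcc.le
          _ = _ := by ring)
    rw [norm_sum_e_neg] at hst
    refine hst.trans ?_
    have hsT : 0 < √T := Real.sqrt_pos.2 hTp
    have hsq : √(k2 ^ 2 * (T / J ^ 2)) = k2 * (√T / J) := by
      rw [Real.sqrt_mul (by positivity), Real.sqrt_sq k2p.le, Real.sqrt_div hTp.le,
        Real.sqrt_sq hJp.le]
    rw [hsq]
    have u1 : √T ≤ J / P := by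
      apply Real.sqrt_le_iff.2
      refine ⟨by positivity, ?_⟩
      rw [div_pow, le_div_iff₀ (by positivity)]; exact hA
    have u2 : P ≤ √T := Real.le_sqrt_of_sq_le hT1
    have u3 : 1 / (k2 * (√T / J)) = (1 / k2) * (J / √T) := by field_simp
    have u4 : J / √T ≤ J / P := by gcongr
    have u5 : 16 * (k2 * (√T / J)) * n ≤ 64 * (J / P) := by
      calc _ ≤ 16 * (1 * (√T / J)) * (4 * J) := by gcongr
        _ = 64 * √T := by field_simp; ring
        _ ≤ _ := by gcongr
    rw [u3]
    have u6 : (1 / k2) * (J / √T) ≤ (1 / k2) * (J / P) := by gcongr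
    have hq : 0 < J / P := by positivity
    have u7 : J / P ≤ (1 / k2) * (J / P) := by nlinarith
    have u8 : 0 ≤ (1 / k3) * (J / P) := by positivity
    have u9 : (650 * (1 / k2) + 200 * (1 / k3)) * (J / P)
        = 650 * ((1 / k2) * (J / P)) + 200 * ((1 / k3) * (J / P)) := by ring
    rw [u9]
    linarith
  · have hl : 0 < k3 ^ 2 * (T / J ^ 3) := by positivity
    have key : ∀ j : ℕ, j + 3 < n → ∃ ξ, M ≤ ξ ∧ ξ ≤ 4 * M ∧
        (c * (m0 + d * (j + 3 : ℕ)) ^ γ) - 3 * (c * (m0 + d * (j + 2 : ℕ)) ^ γ)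
          + 3 * (c * (m0 + d * (j + 1 : ℕ)) ^ γ) - (c * (m0 + d * (j : ℕ)) ^ γ)
          = c * d ^ 3 * (γ * (1 - γ) * (2 - γ)) * ξ ^ (γ - 3) := by
      intro j hj
      have b1 := (hr j (by omega)).1
      have b2 := (hr (j + 3) hj).2
      obtain ⟨ξ, g1, g2, g3⟩ := diff3 γ (m0 + d * j) d (by linarith) hd
      push_cast at b2
      refine ⟨ξ, by linarith, by linarith, ?_⟩
      push_cast
      rw [show m0 + d * ((j : ℝ) + 2) = m0 + d * j + 2 * d by ring,
        show m0 + d * ((j : ℝ) + 1) = m0 + d * j + d by ring,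
        show m0 + d * ((j : ℝ) + 3) = m0 + d * j + 3 * d by ring]
      linear_combination c * g3
    have h64 : (4 : ℝ) ^ 3 = 64 := by norm_num
    have hcc : 0 < c * d ^ 3 * (γ * (1 - γ) * (2 - γ)) := by
      have : 0 < γ * (1 - γ) * (2 - γ) := by linarith
      positivity
    set R := ⌈P ^ 2⌉₊ with hR
    have hP2 : 1 ≤ P ^ 2 := one_le_pow₀ hP
    have hR1 : P ^ 2 ≤ R := Nat.le_ceil _
    have hR2 : (R : ℝ) ≤ 2 * P ^ 2 := by
      have := Nat.ceil_lt_add_one (by positivity : 0 ≤ P ^ 2)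
      linarith
    have hRp : (0 : ℝ) < R := by linarith
    have hRn : 1 ≤ R := by exact_mod_cast hRp
    have hst := third_test (fun j : ℕ => c * (m0 + d * j) ^ γ) n R (k3 ^ 2 * (T / J ^ 3)) 64 hl
      (by norm_num) hRn (by
        intro j hj
        obtain ⟨ξ, g1, g2, g3⟩ := key j hj
        have hp := (pow_range (γ - 3) 3 (by linarith) (by push_cast; linarith) M ξ hM g1 g2).1
        rw [g3, k3s, hTJ3]
        calc _ = c * d ^ 3 * (γ * (1 - γ) * (2 - γ)) * (M ^ (γ - 3) / 4 ^ 3) := by rw [h64]; ring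
          _ ≤ _ := mul_le_mul_of_nonneg_left hp hcc.le) (by
        intro j hj
        obtain ⟨ξ, g1, g2, g3⟩ := key j hj
        have hp := (pow_range (γ - 3) 3 (by linarith) (by push_cast; linarith) M ξ hM g1 g2).2
        rw [g3, k3s, hTJ3]
        calc _ ≤ c * d ^ 3 * (γ * (1 - γ) * (2 - γ)) * M ^ (γ - 3) :=
              mul_le_mul_of_nonneg_left hp hcc.le
          _ = _ := by ring)
    set V := T / J ^ 3 with hV
    have hVp : 0 < V := by positivity
    have hsV : 0 < √V := Real.sqrt_pos.2 hVp
    have hsq : √(k3 ^ 2 * V) = k3 * √V := by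
      rw [Real.sqrt_mul (by positivity), Real.sqrt_sq k3p.le]
    have v1 : √(R * (k3 ^ 2 * V)) ≤ 2 / P ^ 2 := by
      apply Real.sqrt_le_iff.2
      refine ⟨by positivity, ?_⟩
      have w1 : V * P ^ 6 ≤ 1 := by
        rw [hV, div_mul_eq_mul_div, div_le_one (by positivity)]; exact hT2
      rw [div_pow, le_div_iff₀ (by positivity)]
      have w2 : k3 ^ 2 ≤ 1 := by nlinarith
      calc R * (k3 ^ 2 * V) * (P ^ 2) ^ 2 ≤ (2 * P ^ 2) * (1 * V) * (P ^ 2) ^ 2 := by gcongr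
        _ = 2 * (V * P ^ 6) := by ring
        _ ≤ _ := by linarith
    have v2 : 1 / √(k3 ^ 2 * V) ≤ (1 / k3) * (J / P ^ 2) := by
      rw [hsq]
      have w1 : P ^ 2 / J ≤ √V := by
        apply Real.le_sqrt_of_sq_le
        rw [hV, div_pow, div_le_div_iff₀ (by positivity) (by positivity)]
        have : (P ^ 2) ^ 2 * J ^ 3 * P ^ 2 ≤ T * J ^ 2 * P ^ 2 := by
          calc (P ^ 2) ^ 2 * J ^ 3 * P ^ 2 = P ^ 6 * J ^ 3 := by ring
            _ ≤ J * J ^ 3 := by gcongr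
            _ = J ^ 2 * J ^ 2 := by ring
            _ ≤ (T * P ^ 2) * J ^ 2 := by gcongr
            _ = _ := by ring
        exact le_of_mul_le_mul_right this (by positivity)
      calc 1 / (k3 * √V) ≤ 1 / (k3 * (P ^ 2 / J)) := by gcongr
        _ = _ := by field_simp
    have hP26 : P ^ 2 ≤ J := (pow_le_pow_right₀ hP (by norm_num : 2 ≤ 6)).trans hJP
    have hfin : ‖∑ j ∈ range n, e (c * (m0 + d * j) ^ γ)‖ ^ 2 ≤ (200 * (1 / k3) * (J / P)) ^ 2 := by
      refine hst.trans ?_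
      have x1 : (n : ℝ) / R ≤ 4 * J / P ^ 2 := by gcongr
      have x2 : 64 * √(R * (k3 ^ 2 * V)) * n ≤ 64 * (2 / P ^ 2) * (4 * J) := by gcongr
      have x3 : (n : ℝ) + R ≤ 6 * J := by linarith
      set Y := J / P ^ 2 with hY
      have hYp : 0 < Y := by positivity
      have x4 : 4 * J / P ^ 2 = 4 * Y := by rw [hY]; ring
      have x5 : 64 * (2 / P ^ 2) * (4 * J) = 512 * Y := by rw [hY]; ring
      rw [x4] at x1
      rw [x5] at x2
      have x6 : Y ≤ 1 / k3 * Y := by nlinarith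
      calc _ ≤ (6 * J) * (5134 * (1 / k3 * Y)) := by
            apply mul_le_mul x3 _ (by positivity) (by positivity)
            nlinarith
        _ = 30804 * (1 / k3) * (J / P) ^ 2 := by rw [hY]; field_simp; ring
        _ ≤ 40000 * (1 / k3) ^ 2 * (J / P) ^ 2 := by
            apply mul_le_mul_of_nonneg_right _ (by positivity)
            nlinarith
        _ = _ := by ring
    have := abs_le_of_sq_le_sq' hfin (by positivity)
    have hq : 0 < J / P := by positivity
    have : 0 ≤ (1 / k2) * (J / P) := by positivity
    have u9 : (650 * (1 / k2) + 200 * (1 / k3)) * (J / P)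
        = 650 * ((1 / k2) * (J / P)) + 200 * (1 / k3) * (J / P) := by ring
    rw [u9]
    linarith

/-- Exponential sum over an arithmetic progression, either sign. -/
lemma expSum (γ : ℝ) (h0 : 0 < γ) (hγ1 : γ < 1) :
    ∃ C : ℝ, 1 ≤ C ∧ ∀ (c M d P m0 : ℝ) (n : ℕ), 0 < M → 0 < d → 1 ≤ P →
      (∀ j < n, M ≤ m0 + d * j ∧ m0 + d * j ≤ 4 * M) →
      P ^ 2 ≤ |c| * M ^ γ → |c| * M ^ γ * P ^ 6 ≤ (M / d) ^ 3 → P ^ 6 ≤ M / d →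
      ‖∑ j ∈ range n, e (c * (m0 + d * j) ^ γ)‖ ≤ C * (M / d / P) := by
  obtain ⟨C, hC, h⟩ := expSum_pos γ h0 hγ1
  refine ⟨C, hC, ?_⟩
  intro c M d P m0 n hM hd hP hr h1 h2 h3
  rcases lt_trichotomy c 0 with hc | hc | hc
  · rw [abs_of_neg hc] at h1 h2
    have := h (-c) M d P m0 n (by linarith) hM hd hP hr h1 h2 h3
    rw [← norm_sum_e_neg]
    simpa [neg_mul] using this
  · subst hc
    simp at h1
    nlinarith
  · rw [abs_of_pos hc] at h1 h2
    exact h c M d P m0 n hc hM hd hP hr h1 h2 h3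

end PS

namespace PS
open Finset

/-- `s` is (the set of elements of) an arithmetic progression with difference `d`. -/
def IsAP (d : ℕ) (s : Finset ℕ) : Prop :=
  (∀ x ∈ s, ∀ y ∈ s, x ≡ y [MOD d]) ∧
    ∀ x ∈ s, ∀ y ∈ s, ∀ z, x ≤ z → z ≤ y → z ≡ x [MOD d] → z ∈ s

lemma IsAP.enum {d : ℕ} (hd : 1 ≤ d) {s : Finset ℕ} (h : IsAP d s) :
    ∃ m0 n : ℕ, (∀ j < n, m0 + d * j ∈ s) ∧ s.card = n ∧
      ∀ F : ℕ → ℂ, ∑ x ∈ s, F x = ∑ j ∈ range n, F (m0 + d * j) := by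
  rcases s.eq_empty_or_nonempty with h0 | h0
  · subst h0; exact ⟨0, 0, by simp, by simp, by simp⟩
  set a := s.min' h0
  set b := s.max' h0
  have ha : a ∈ s := s.min'_mem h0
  have hb : b ∈ s := s.max'_mem h0
  have hab : a ≤ b := s.min'_le_max' h0
  obtain ⟨q, hq⟩ : d ∣ b - a := (Nat.modEq_iff_dvd' hab).1 (h.1 a ha b hb)
  have hmem : ∀ j < q + 1, a + d * j ∈ s := by
    intro j hj
    apply h.2 a ha b hb _ (by omega)
    · have : d * j ≤ d * q := Nat.mul_le_mul_left d (by omega)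
      omega
    · have : a + d * j ≡ a + 0 [MOD d] :=
        Nat.ModEq.add_left a ((Nat.modEq_zero_iff_dvd).2 (dvd_mul_right d j))
      simpa using this
  have hinj : Set.InjOn (fun j => a + d * j) (range (q + 1) : Set ℕ) := by
    intro i _ j _ hij
    have : d * i = d * j := by simpa using hij
    exact Nat.eq_of_mul_eq_mul_left (by omega) this
  have himg : s = (range (q + 1)).image (fun j => a + d * j) := by
    ext x
    rw [mem_image]
    constructor
    · intro hx
      have hax : a ≤ x := s.min'_le x hx
      have hxb : x ≤ b := s.le_max' x hx
      obtain ⟨i, hi⟩ : d ∣ x - a := (Nat.modEq_iff_dvd' hax).1 (h.1 a ha x hx)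
      refine ⟨i, ?_, by omega⟩
      rw [mem_range]
      have : d * i ≤ d * q := by omega
      have := Nat.le_of_mul_le_mul_left this (by omega)
      omega
    · rintro ⟨j, hj, rfl⟩
      exact hmem j (mem_range.1 hj)
  refine ⟨a, q + 1, hmem, ?_, ?_⟩
  · conv_lhs => rw [himg]
    rw [card_image_of_injOn hinj, card_range]
  · intro F
    conv_lhs => rw [himg]
    rw [sum_image hinj]

lemma IsAP.card_le {d : ℕ} (hd : 1 ≤ d) {s : Finset ℕ} (h : IsAP d s) (M : ℝ)
    (hr : ∀ x ∈ s, M ≤ (x : ℝ) ∧ (x : ℝ) ≤ 4 * M) (hM : (d : ℝ) ≤ M) :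
    (s.card : ℝ) ≤ 4 * (M / d) := by
  obtain ⟨m0, n, h1, h2, -⟩ := h.enum hd
  have hd0 : (0 : ℝ) < d := by exact_mod_cast hd
  rw [h2, ← mul_div_assoc, le_div_iff₀ hd0]
  rcases Nat.eq_zero_or_pos n with h | h
  · subst h; simp; linarith
  · have a1 := (hr _ (h1 0 h)).1
    have a2 := (hr _ (h1 (n - 1) (by omega))).2
    have a3 : ((n - 1 : ℕ) : ℝ) = n - 1 := by rw [Nat.cast_sub h]; simp
    push_cast at a1 a2
    rw [a3] at a2
    simp only [mul_zero, add_zero] at a1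
    linarith

lemma abel_bound (a : ℕ → ℝ) (z : ℕ → ℂ) (n : ℕ) (B : ℝ) (ha0 : 0 ≤ a 0)
    (ha : ∀ j, a j ≤ a (j + 1)) (hB : ∀ i ≤ n + 1, ‖∑ j ∈ range i, z j‖ ≤ B) :
    ‖∑ j ∈ range (n + 1), (a j : ℂ) * z j‖ ≤ 2 * a n * B := by
  have hB0 : 0 ≤ B := (norm_nonneg _).trans (hB 0 (by omega))
  have hm : ∀ i, 0 ≤ a i := by
    intro i
    induction i with
    | zero => exact ha0
    | succ i ih => exact ih.trans (ha i)
  have claim : ∀ i ≤ n, ‖∑ j ∈ range (i + 1), (a j : ℂ) * z j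
      - (a i : ℂ) * ∑ j ∈ range (i + 1), z j‖ ≤ (a i - a 0) * B := by
    intro i
    induction i with
    | zero => intro _; simp
    | succ i ih =>
      intro hi
      have ih' := ih (by omega)
      have e1 : ∑ j ∈ range (i + 1 + 1), (a j : ℂ) * z j
          - (a (i + 1) : ℂ) * ∑ j ∈ range (i + 1 + 1), z j
          = (∑ j ∈ range (i + 1), (a j : ℂ) * z j - (a i : ℂ) * ∑ j ∈ range (i + 1), z j)
            - ((a (i + 1) - a i : ℝ) : ℂ) * ∑ j ∈ range (i + 1), z j := by
        rw [sum_range_succ _ (i + 1), sum_range_succ _ (i + 1)]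
        push_cast; ring
      rw [e1]
      refine (norm_sub_le _ _).trans ?_
      rw [norm_mul, Complex.norm_real, Real.norm_of_nonneg (by linarith [ha i])]
      have := mul_le_mul_of_nonneg_left (hB (i + 1) (by omega))
        (by linarith [ha i] : 0 ≤ a (i + 1) - a i)
      linarith
  have hc := claim n le_rfl
  have e2 : ∑ j ∈ range (n + 1), (a j : ℂ) * z j = (∑ j ∈ range (n + 1), (a j : ℂ) * z j
      - (a n : ℂ) * ∑ j ∈ range (n + 1), z j) + (a n : ℂ) * ∑ j ∈ range (n + 1), z j := by ring
  rw [e2]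
  refine (norm_add_le _ _).trans ?_
  rw [norm_mul, Complex.norm_real, Real.norm_of_nonneg (hm n)]
  have := mul_le_mul_of_nonneg_left (hB (n + 1) le_rfl) (hm n)
  have := mul_nonneg ha0 hB0
  linarith

lemma expSum_set (γ : ℝ) (h0 : 0 < γ) (hγ1 : γ < 1) :
    ∃ C : ℝ, 1 ≤ C ∧ ∀ (c M P : ℝ) (d : ℕ) (s : Finset ℕ), 0 < M → 1 ≤ d → 1 ≤ P →
      IsAP d s → (∀ x ∈ s, M ≤ (x : ℝ) ∧ (x : ℝ) ≤ 4 * M) →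
      P ^ 2 ≤ |c| * M ^ γ → |c| * M ^ γ * P ^ 6 ≤ (M / d) ^ 3 → P ^ 6 ≤ M / d →
      ‖∑ x ∈ s, e (c * (x : ℝ) ^ γ)‖ ≤ C * (M / d / P) ∧
      ‖∑ x ∈ s, ((Real.log x : ℝ) : ℂ) * e (c * (x : ℝ) ^ γ)‖
        ≤ 2 * Real.log (4 * M) * (C * (M / d / P)) := by
  obtain ⟨C, hC, h⟩ := expSum γ h0 hγ1
  refine ⟨C, hC, ?_⟩
  intro c M P d s hM hd hP hs hr h1 h2 h3
  obtain ⟨m0, n, g1, g2, g3⟩ := hs.enum hd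
  have hd0 : (0 : ℝ) < d := by exact_mod_cast hd
  have hd1 : (1 : ℝ) ≤ d := by exact_mod_cast hd
  have hM1 : 1 ≤ M := by
    have : 1 ≤ M / d := (one_le_pow₀ hP).trans h3
    rw [le_div_iff₀ hd0] at this; linarith
  have hall : ∀ i ≤ n, ‖∑ j ∈ range i, e (c * ((m0 + d * j : ℕ) : ℝ) ^ γ)‖ ≤ C * (M / d / P) := by
    intro i hi
    have := h c M d P m0 i hM hd0 hP (by
      intro j hj
      have := hr _ (g1 j (by omega))
      push_cast at this
      exact this) h1 h2 h3
    push_cast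
    exact this
  refine ⟨by rw [g3]; exact hall n le_rfl, ?_⟩
  rw [g3]
  rcases Nat.eq_zero_or_pos n with hn | hn
  · subst hn
    simp
    have : 0 ≤ Real.log (4 * M) := Real.log_nonneg (by linarith)
    positivity
  obtain ⟨n, rfl⟩ : ∃ i, n = i + 1 := ⟨n - 1, by omega⟩
  have hm0 : 1 ≤ (m0 : ℝ) := by
    have := (hr _ (g1 0 hn)).1
    push_cast at this
    linarith
  have := abel_bound (fun j => Real.log ((m0 + d * j : ℕ) : ℝ))
    (fun j => e (c * ((m0 + d * j : ℕ) : ℝ) ^ γ)) n (C * (M / d / P))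
    (Real.log_natCast_nonneg _) (by
      intro j
      apply Real.log_le_log
      · push_cast; positivity
      · push_cast; nlinarith) hall
  refine this.trans ?_
  have h4 := hr _ (g1 n (by omega))
  have h5 : Real.log ((m0 + d * n : ℕ) : ℝ) ≤ Real.log (4 * M) :=
    Real.log_le_log (by linarith [h4.1]) h4.2
  gcongr

end PS

namespace PS
open Finset

lemma bilinear (Ls Ms : Finset ℕ) (β α : ℕ → ℝ) (χ : ℕ → ℕ → ℂ) (bl : ℕ → ℕ) (nb B : ℝ)
    (hnb : ((Ls.image bl).card : ℝ) ≤ nb)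
    (hB : ∀ l ∈ Ls, ∑ l' ∈ Ls.filter (fun l' => bl l' = bl l),
      ‖∑ m ∈ Ms, χ l m * (starRingEnd ℂ) (χ l' m)‖ ≤ B) :
    ‖∑ l ∈ Ls, ∑ m ∈ Ms, (β l : ℂ) * (α m : ℂ) * χ l m‖ ^ 2
      ≤ nb * (∑ m ∈ Ms, α m ^ 2) * ((∑ l ∈ Ls, β l ^ 2) * B) := by
  set Bs := Ls.image bl with hBs
  set fib : ℕ → Finset ℕ := fun b => Ls.filter (fun l => bl l = b) with hfib
  set y : ℕ → ℕ → ℂ := fun b m => ∑ l ∈ fib b, (β l : ℂ) * χ l m with hy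
  set E : ℕ → ℕ → ℂ := fun l l' => ∑ m ∈ Ms, χ l m * (starRingEnd ℂ) (χ l' m) with hE
  have hmaps : ∀ l ∈ Ls, bl l ∈ Bs := fun l hl => mem_image_of_mem _ hl
  have hEsym : ∀ l l', ‖E l l'‖ = ‖E l' l‖ := by
    intro l l'
    rw [← RCLike.norm_conj (E l l')]
    simp only [hE]
    rw [map_sum]
    congr 1
    apply sum_congr rfl
    intro m _
    rw [map_mul, RCLike.conj_conj, mul_comm]
  have e1 : ∑ l ∈ Ls, ∑ m ∈ Ms, (β l : ℂ) * (α m : ℂ) * χ l m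
      = ∑ p ∈ Bs ×ˢ Ms, (α p.2 : ℂ) * y p.1 p.2 := by
    rw [sum_product, ← sum_fiberwise_of_maps_to hmaps]
    apply sum_congr rfl
    intro b _
    rw [sum_comm]
    apply sum_congr rfl
    intro m _
    simp only [hy]
    rw [mul_sum]
    apply sum_congr rfl
    intro l _
    ring
  have e2 : ‖∑ l ∈ Ls, ∑ m ∈ Ms, (β l : ℂ) * (α m : ℂ) * χ l m‖ ^ 2
      ≤ (∑ p ∈ Bs ×ˢ Ms, α p.2 ^ 2) * ∑ p ∈ Bs ×ˢ Ms, ‖y p.1 p.2‖ ^ 2 := by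
    rw [e1]
    calc _ ≤ (∑ p ∈ Bs ×ˢ Ms, |α p.2| * ‖y p.1 p.2‖) ^ 2 := by
          gcongr
          refine (norm_sum_le _ _).trans (le_of_eq ?_)
          apply sum_congr rfl
          intro p _
          rw [norm_mul, Complex.norm_real, Real.norm_eq_abs]
      _ ≤ _ := by
          have := sum_mul_sq_le_sq_mul_sq (Bs ×ˢ Ms) (fun p => |α p.2|) (fun p => ‖y p.1 p.2‖)
          simpa only [sq_abs] using this
  have e3 : ∑ p ∈ Bs ×ˢ Ms, α p.2 ^ 2 ≤ nb * ∑ m ∈ Ms, α m ^ 2 := by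
    rw [sum_product]
    show (∑ _x ∈ Bs, ∑ y ∈ Ms, α y ^ 2) ≤ _
    rw [sum_const, nsmul_eq_mul]
    exact mul_le_mul_of_nonneg_right hnb (sum_nonneg fun _ _ => sq_nonneg _)
  have e4 : ((∑ p ∈ Bs ×ˢ Ms, ‖y p.1 p.2‖ ^ 2 : ℝ) : ℂ)
      = ∑ b ∈ Bs, ∑ l ∈ fib b, ∑ l' ∈ fib b, (β l : ℂ) * (β l' : ℂ) * E l l' := by
    push_cast
    rw [sum_product]
    apply sum_congr rfl
    intro b _
    have : ∀ m, ((‖y b m‖ : ℂ)) ^ 2 = ∑ l ∈ fib b, ∑ l' ∈ fib b,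
        (β l : ℂ) * (β l' : ℂ) * (χ l m * (starRingEnd ℂ) (χ l' m)) := by
      intro m
      rw [← Complex.mul_conj']
      simp only [hy]
      rw [map_sum, sum_mul_sum]
      apply sum_congr rfl; intro l _
      apply sum_congr rfl; intro l' _
      rw [map_mul, Complex.conj_ofReal]; ring
    simp_rw [this]
    rw [sum_comm]
    apply sum_congr rfl; intro l _
    rw [sum_comm]
    apply sum_congr rfl; intro l' _
    simp only [hE]
    rw [mul_sum]
  have e5 : ∑ p ∈ Bs ×ˢ Ms, ‖y p.1 p.2‖ ^ 2 ≤ (∑ l ∈ Ls, β l ^ 2) * B := by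
    have h0 : 0 ≤ ∑ p ∈ Bs ×ˢ Ms, ‖y p.1 p.2‖ ^ 2 := by positivity
    have : ∑ p ∈ Bs ×ˢ Ms, ‖y p.1 p.2‖ ^ 2
        = ‖((∑ p ∈ Bs ×ˢ Ms, ‖y p.1 p.2‖ ^ 2 : ℝ) : ℂ)‖ := by
      rw [Complex.norm_real, Real.norm_of_nonneg h0]
    rw [this, e4]
    have hb : ∀ b ∈ Bs, ‖∑ l ∈ fib b, ∑ l' ∈ fib b, (β l : ℂ) * (β l' : ℂ) * E l l'‖
        ≤ ∑ l ∈ fib b, β l ^ 2 * B := by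
      intro b _
      calc _ ≤ ∑ l ∈ fib b, ∑ l' ∈ fib b, ‖(β l : ℂ) * (β l' : ℂ) * E l l'‖ := by
            refine (norm_sum_le _ _).trans ?_
            exact sum_le_sum fun l _ => norm_sum_le _ _
        _ ≤ ∑ l ∈ fib b, ∑ l' ∈ fib b,
            (β l ^ 2 / 2 * ‖E l l'‖ + β l' ^ 2 / 2 * ‖E l' l‖) := by
            apply sum_le_sum; intro l _
            apply sum_le_sum; intro l' _
            rw [norm_mul, norm_mul, Complex.norm_real, Complex.norm_real, Real.norm_eq_abs,
              Real.norm_eq_abs, ← hEsym l l']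
            have h1 : |β l| * |β l'| ≤ β l ^ 2 / 2 + β l' ^ 2 / 2 := by
              have := sq_nonneg (|β l| - |β l'|)
              rw [← sq_abs (β l), ← sq_abs (β l')]
              nlinarith
            have := mul_le_mul_of_nonneg_right h1 (norm_nonneg (E l l'))
            linarith
        _ = ∑ l ∈ fib b, ∑ l' ∈ fib b, β l ^ 2 * ‖E l l'‖ := by
            simp_rw [sum_add_distrib]
            rw [sum_comm (f := fun l l' => β l' ^ 2 / 2 * ‖E l' l‖), ← sum_add_distrib]
            apply sum_congr rfl; intro l _
            rw [← sum_add_distrib]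
            apply sum_congr rfl; intro l' _
            ring
        _ ≤ _ := by
            apply sum_le_sum; intro l hl
            rw [← mul_sum]
            apply mul_le_mul_of_nonneg_left _ (sq_nonneg _)
            have hl' := mem_filter.1 hl
            have := hB l hl'.1
            rw [hl'.2] at this
            exact this
    refine (norm_sum_le _ _).trans ((sum_le_sum hb).trans (le_of_eq ?_))
    rw [sum_fiberwise_of_maps_to hmaps, sum_mul]
  refine e2.trans ?_
  exact mul_le_mul e3 e5 (by positivity) ((sum_nonneg fun _ _ => sq_nonneg _).trans e3)

/-- the twisted indicator -/
noncomputable def Gf (γ k N : ℝ) (d : ℕ) (a : ℤ) (n : ℕ) : ℂ :=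
  open scoped Classical in
  if N < (n : ℝ) ∧ (n : ℝ) ≤ 2 * N ∧ (d : ℤ) ∣ (n : ℤ) - a then e (k * (n : ℝ) ^ γ) else 0

lemma norm_Gf_le (γ k N : ℝ) (d : ℕ) (a : ℤ) (n : ℕ) : ‖Gf γ k N d a n‖ ≤ 1 := by
  unfold Gf; split_ifs <;> simp [norm_e]

/-- integers in `[M, 4M]` -/
noncomputable def Rg (M : ℝ) : Finset ℕ := Icc ⌈M⌉₊ ⌊4 * M⌋₊

lemma mem_Rg {M : ℝ} (hM : 0 ≤ M) {x : ℕ} : x ∈ Rg M ↔ M ≤ (x : ℝ) ∧ (x : ℝ) ≤ 4 * M := by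
  unfold Rg
  rw [mem_Icc, Nat.ceil_le, Nat.le_floor_iff (by positivity)]

lemma cop_of_dvd {d : ℕ} {a : ℤ} (ha : Int.gcd (d : ℤ) a = 1) {l m : ℕ}
    (h : (d : ℤ) ∣ ((l * m : ℕ) : ℤ) - a) : Nat.Coprime d l := by
  have h1 : IsCoprime (d : ℤ) a := Int.isCoprime_iff_gcd_eq_one.2 ha
  obtain ⟨q, hq⟩ := h
  have h2 : IsCoprime (d : ℤ) (l : ℤ) := by
    have h3 : IsCoprime (d : ℤ) (a + d * q) := IsCoprime.add_mul_left_right h1 q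
    have h4 : a + d * q = (l : ℤ) * m := by push_cast at hq; linarith
    rw [h4] at h3
    exact IsCoprime.of_mul_right_left h3
  exact Nat.isCoprime_iff_coprime.1 h2

lemma dvd_iff_modEq {d : ℕ} {a : ℤ} {x y : ℕ} (hx : (d : ℤ) ∣ (x : ℤ) - a) :
    (d : ℤ) ∣ (y : ℤ) - a ↔ x ≡ y [MOD d] := by
  rw [Nat.modEq_iff_dvd]
  constructor
  · intro h
    have := dvd_sub h hx
    simpa using this
  · intro h
    have := dvd_add h hx
    simpa using this

/-- AP property of the set of admissible `m` for finitely many `l`. -/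
lemma isAP_filter {d : ℕ} {a : ℤ} (ha : Int.gcd (d : ℤ) a = 1) (N : ℝ) (l l' : ℕ)
    (u v : ℕ) (s : Finset ℕ)
    (hs : ∀ x, x ∈ s ↔ x ∈ Icc u v ∧ (N < ((l * x : ℕ) : ℝ) ∧ ((l * x : ℕ) : ℝ) ≤ 2 * N ∧
      (d : ℤ) ∣ ((l * x : ℕ) : ℤ) - a) ∧ (N < ((l' * x : ℕ) : ℝ) ∧ ((l' * x : ℕ) : ℝ) ≤ 2 * N ∧
      (d : ℤ) ∣ ((l' * x : ℕ) : ℤ) - a)) : IsAP d s := by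
  constructor
  · intro x hx y hy
    have h1 := ((hs x).1 hx).2.1.2.2
    have h2 := ((hs y).1 hy).2.1.2.2
    have h3 := cop_of_dvd ha h1
    exact Nat.ModEq.cancel_left_of_coprime h3 ((dvd_iff_modEq h1).1 h2)
  · intro x hx y hy z hxz hzy hz
    obtain ⟨a1, ⟨a2, a3, a4⟩, ⟨a5, a6, a7⟩⟩ := (hs x).1 hx
    obtain ⟨b1, ⟨b2, b3, b4⟩, ⟨b5, b6, b7⟩⟩ := (hs y).1 hy
    rw [hs]
    rw [mem_Icc] at *
    have c1 : ((l * x : ℕ) : ℝ) ≤ ((l * z : ℕ) : ℝ) := by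
      exact_mod_cast Nat.mul_le_mul_left l hxz
    have c2 : ((l * z : ℕ) : ℝ) ≤ ((l * y : ℕ) : ℝ) := by
      exact_mod_cast Nat.mul_le_mul_left l hzy
    have c3 : ((l' * x : ℕ) : ℝ) ≤ ((l' * z : ℕ) : ℝ) := by
      exact_mod_cast Nat.mul_le_mul_left l' hxz
    have c4 : ((l' * z : ℕ) : ℝ) ≤ ((l' * y : ℕ) : ℝ) := by
      exact_mod_cast Nat.mul_le_mul_left l' hzy
    refine ⟨by omega, ⟨by linarith, by linarith, ?_⟩, ⟨by linarith, by linarith, ?_⟩⟩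
    · exact (dvd_iff_modEq a4).2 (Nat.ModEq.mul_left l hz.symm)
    · exact (dvd_iff_modEq a7).2 (Nat.ModEq.mul_left l' hz.symm)

lemma card_block (s : Finset ℕ) (d Q b l : ℕ) (hQ : 1 ≤ Q) (hd : 1 ≤ d) :
    (s.filter (fun l' => l' / (d * Q) = b ∧ l' ≡ l [MOD d])).card ≤ Q := by
  refine le_trans ?_ (le_of_eq (card_range Q))
  apply card_le_card_of_injOn (fun x => (x % (d * Q)) / d)
  · intro x _
    simp only [coe_range, Set.mem_Iio]
    apply Nat.div_lt_of_lt_mul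
    exact Nat.mod_lt _ (by positivity)
  · intro x hx y hy hxy
    have hx' := (mem_filter.1 (mem_coe.1 hx)).2
    have hy' := (mem_filter.1 (mem_coe.1 hy)).2
    simp only at hxy
    have h1 : x % (d * Q) % d = y % (d * Q) % d := by
      rw [Nat.mod_mul_right_mod, Nat.mod_mul_right_mod]
      exact hx'.2.trans hy'.2.symm
    have h2 : x % (d * Q) = y % (d * Q) := by
      rw [← Nat.div_add_mod (x % (d * Q)) d, ← Nat.div_add_mod (y % (d * Q)) d, h1, hxy]
    rw [← Nat.div_add_mod x (d * Q), ← Nat.div_add_mod y (d * Q), h2, hx'.1, hy'.1]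

end PS

namespace PS
open Finset

open scoped Classical in
lemma E_eq (γ k N : ℝ) (d : ℕ) (a : ℤ) (Ms : Finset ℕ) (l l' : ℕ) :
    ∑ m ∈ Ms, Gf γ k N d a (l * m) * (starRingEnd ℂ) (Gf γ k N d a (l' * m))
    = ∑ m ∈ Ms.filter (fun x => (N < ((l * x : ℕ) : ℝ) ∧ ((l * x : ℕ) : ℝ) ≤ 2 * N ∧
      (d : ℤ) ∣ ((l * x : ℕ) : ℤ) - a) ∧ (N < ((l' * x : ℕ) : ℝ) ∧ ((l' * x : ℕ) : ℝ) ≤ 2 * N ∧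
      (d : ℤ) ∣ ((l' * x : ℕ) : ℤ) - a)),
      e (k * ((l : ℝ) ^ γ - (l' : ℝ) ^ γ) * (m : ℝ) ^ γ) := by
  rw [sum_filter]
  apply sum_congr rfl
  intro m _
  unfold Gf
  by_cases h1 : (N < ((l * m : ℕ) : ℝ) ∧ ((l * m : ℕ) : ℝ) ≤ 2 * N ∧
      (d : ℤ) ∣ ((l * m : ℕ) : ℤ) - a)
  · by_cases h2 : (N < ((l' * m : ℕ) : ℝ) ∧ ((l' * m : ℕ) : ℝ) ≤ 2 * N ∧
      (d : ℤ) ∣ ((l' * m : ℕ) : ℤ) - a)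
    · rw [if_pos h1, if_pos h2, if_pos ⟨h1, h2⟩, ← e_neg, ← e_add]
      congr 1
      push_cast
      rw [Real.mul_rpow (by positivity) (by positivity),
        Real.mul_rpow (by positivity) (by positivity)]
      ring
    · rw [if_neg h2, map_zero, mul_zero]
      exact (if_neg (fun h => h2 h.2)).symm
  · rw [if_neg h1, zero_mul]
    exact (if_neg (fun h => h1 h.1)).symm

lemma modEq_of_both {d : ℕ} {a : ℤ} (ha : Int.gcd (d : ℤ) a = 1) {l l' m : ℕ}
    (h : (d : ℤ) ∣ ((l * m : ℕ) : ℤ) - a) (h' : (d : ℤ) ∣ ((l' * m : ℕ) : ℤ) - a) :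
    l' ≡ l [MOD d] := by
  have h3 : Nat.Coprime d m := by
    rw [mul_comm] at h
    exact cop_of_dvd ha h
  exact (Nat.ModEq.cancel_right_of_coprime h3 ((dvd_iff_modEq h).1 h')).symm

lemma diff_bounds (γ : ℝ) (h0 : 1 / 2 ≤ γ) (hγ1 : γ < 1) (N k P L M : ℝ) (d : ℕ)
    (hL : 0 < L) (hM : 0 < M) (hML : M * L = N / 2) (x y : ℝ) (hx : L ≤ x)
    (hy : y ≤ 4 * L) (h1 : x + d ≤ y) (hd : 1 ≤ d) (h2 : y - x ≤ d * P) :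
    |k| * N ^ γ * d / (16 * L) ≤ |k| * (y ^ γ - x ^ γ) * M ^ γ ∧
    |k| * (y ^ γ - x ^ γ) * M ^ γ ≤ |k| * N ^ γ * (d * P / L) ∧ 0 ≤ y ^ γ - x ^ γ := by
  have hd' : (1 : ℝ) ≤ d := by exact_mod_cast hd
  obtain ⟨ξ, a1, a2, a3⟩ := diff1 γ x (y - x) (by linarith) (by linarith)
  rw [add_sub_cancel] at a2 a3
  obtain ⟨b1, b2⟩ := pow_range (γ - 1) 1 (by linarith) (by norm_num; linarith) L ξ hL
    (by linarith) (by linarith)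
  have hN : 0 < N := by nlinarith [mul_pos hM hL]
  have hLM : L ^ (γ - 1) * M ^ γ = N ^ γ / 2 ^ γ / L := by
    rw [Real.rpow_sub hL, Real.rpow_one, ← Real.div_rpow hN.le (by norm_num), ← hML,
      Real.mul_rpow hM.le hL.le]
    field_simp
  have h2a : (2 : ℝ) ^ γ ≤ 2 := by
    calc (2 : ℝ) ^ γ ≤ 2 ^ (1 : ℝ) := Real.rpow_le_rpow_of_exponent_le (by norm_num) hγ1.le
      _ = 2 := by norm_num
  have h2b : (1 : ℝ) ≤ 2 ^ γ := Real.one_le_rpow (by norm_num) (by linarith)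
  have hNγ : 0 < N ^ γ := by positivity
  have hMγ : 0 < M ^ γ := by positivity
  have hLγ : 0 < L ^ (γ - 1) := by positivity
  have c1 : N ^ γ / 2 / L ≤ L ^ (γ - 1) * M ^ γ := by
    rw [hLM]; gcongr
  have c2 : L ^ (γ - 1) * M ^ γ ≤ N ^ γ / L := by
    rw [hLM]
    gcongr
    exact div_le_self hNγ.le h2b
  rw [a3]
  have hyx : 0 < y - x := by linarith
  have hξ : 0 < ξ := by linarith
  have hγ0 : 0 < γ := by linarith
  have hdP : 0 ≤ d * P := by linarith
  refine ⟨?_, ?_, by positivity⟩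
  · calc |k| * N ^ γ * d / (16 * L) = |k| * (d * (1 / 2 * (1 / 4))) * (N ^ γ / 2 / L) := by
          field_simp; norm_num; ring
      _ ≤ |k| * (d * (1 / 2 * (1 / 4))) * (L ^ (γ - 1) * M ^ γ) := by gcongr
      _ = |k| * (d * (1 / 2 * (L ^ (γ - 1) / 4 ^ 1))) * M ^ γ := by ring
      _ ≤ _ := by
          gcongr
          linarith
  · calc |k| * ((y - x) * (γ * ξ ^ (γ - 1))) * M ^ γ
        ≤ |k| * (d * P * (1 * L ^ (γ - 1))) * M ^ γ := by
          gcongr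
      _ = |k| * (d * P) * (L ^ (γ - 1) * M ^ γ) := by ring
      _ ≤ |k| * (d * P) * (N ^ γ / L) := by
          gcongr
      _ = _ := by ring

lemma box (γ : ℝ) (h0 : 1 / 2 ≤ γ) (hγ1 : γ < 1) : ∃ C, 1 ≤ C ∧
    ∀ (N k P L M : ℝ) (d : ℕ) (a : ℤ) (β α : ℕ → ℝ), 0 < L → 0 < M → M * L = N / 2 →
    1 ≤ d → 1 ≤ P → Int.gcd (d : ℤ) a = 1 → d * P ≤ 4 * L →
    P ^ 2 ≤ |k| * N ^ γ * d / (16 * L) →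
    |k| * N ^ γ * (d * P / L) * P ^ 6 ≤ (M / d) ^ 3 → P ^ 6 ≤ M / d →
    ‖∑ l ∈ Rg L, ∑ m ∈ Rg M, (β l : ℂ) * (α m : ℂ) * Gf γ k N d a (l * m)‖ ^ 2
      ≤ C * (∑ m ∈ Rg M, α m ^ 2) * (∑ l ∈ Rg L, β l ^ 2) * (L / (d * P)) * (M / d) := by
  classical
  obtain ⟨C, hC1, hC⟩ := expSum_set γ (by linarith) hγ1
  refine ⟨12 * (4 + C), by linarith, ?_⟩
  intro N k P L M d a β α hL hM hML hd hP ha hdP hT1 hT2 hJ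
  have hd' : (1 : ℝ) ≤ d := by exact_mod_cast hd
  have hMd : 0 < M / d := by positivity
  have hdM : (d : ℝ) ≤ M := by
    have : (1 : ℝ) ≤ M / d := (one_le_pow₀ hP).trans hJ
    rwa [le_div_iff₀ (by positivity), one_mul] at this
  set Q := ⌊P⌋₊ with hQ
  have hQ1 : 1 ≤ Q := Nat.one_le_floor_iff P |>.2 hP
  have hQ1' : (1 : ℝ) ≤ Q := by exact_mod_cast hQ1
  have hQP : (Q : ℝ) ≤ P := Nat.floor_le (by linarith)
  have hPQ : P ≤ 2 * Q := by
    have := Nat.lt_floor_add_one P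
    rw [← hQ] at this
    linarith
  have hPpos : 0 < P := by linarith
  have key : ∀ l ∈ Rg L, ∀ l' ∈ Rg L, ∀ s : Finset ℕ, IsAP d s →
      (∀ x ∈ s, M ≤ (x : ℝ) ∧ (x : ℝ) ≤ 4 * M) → l ≠ l' → l' / (d * Q) = l / (d * Q) →
      l' ≡ l [MOD d] →
      ‖∑ m ∈ s, e (k * ((l : ℝ) ^ γ - (l' : ℝ) ^ γ) * (m : ℝ) ^ γ)‖ ≤ C * (M / d / P) := by
    intro l hl l' hl' s hs hr hne hbl hmod
    rw [mem_Rg hL.le] at hl hl'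
    refine (hC (k * ((l : ℝ) ^ γ - (l' : ℝ) ^ γ)) M P d s hM hd hP hs hr ?_ ?_ hJ).1
    all_goals rw [abs_mul]
    all_goals
      have main : |k| * N ^ γ * d / (16 * L) ≤ |k| * |(l : ℝ) ^ γ - (l' : ℝ) ^ γ| * M ^ γ ∧
        |k| * |(l : ℝ) ^ γ - (l' : ℝ) ^ γ| * M ^ γ ≤ |k| * N ^ γ * (d * P / L) := by
        have gen : ∀ x y : ℕ, (L ≤ (x : ℝ) ∧ (x : ℝ) ≤ 4 * L) → (L ≤ (y : ℝ) ∧ (y : ℝ) ≤ 4 * L) →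
            x < y → x / (d * Q) = y / (d * Q) → x ≡ y [MOD d] →
            |k| * N ^ γ * d / (16 * L) ≤ |k| * |(y : ℝ) ^ γ - (x : ℝ) ^ γ| * M ^ γ ∧
            |k| * |(y : ℝ) ^ γ - (x : ℝ) ^ γ| * M ^ γ ≤ |k| * N ^ γ * (d * P / L) := by
          intro x y hx hy hxy hb hm
          have q1 : x + d ≤ y := by
            have := (Nat.modEq_iff_dvd' hxy.le).1 hm
            have := Nat.le_of_dvd (by omega) this
            omega
          have q2 : y ≤ x + d * Q := by
            have e1 := Nat.div_add_mod x (d * Q)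
            have e2 := Nat.div_add_mod y (d * Q)
            have e3 := Nat.mod_lt y (show 0 < d * Q by positivity)
            rw [hb] at e1
            omega
          have q1' : (x : ℝ) + d ≤ y := by exact_mod_cast q1
          have q2' : (y : ℝ) ≤ x + d * Q := by exact_mod_cast q2
          have q3 : (y : ℝ) - x ≤ d * P := by
            have : (d : ℝ) * Q ≤ d * P := by gcongr
            linarith
          obtain ⟨r1, r2, r3⟩ := diff_bounds γ h0 hγ1 N k P L M d hL hM hML x y hx.1 hy.2 q1' hd q3
          rw [abs_of_nonneg r3]
          exact ⟨r1, r2⟩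
        rcases lt_or_gt_of_ne hne with h | h
        · rw [abs_sub_comm]
          exact gen l l' hl hl' h hbl.symm hmod.symm
        · exact gen l' l hl' hl h hbl hmod
    · exact hT1.trans main.1
    · refine le_trans ?_ hT2
      exact mul_le_mul_of_nonneg_right main.2 (by positivity)
  have hB : ∀ l ∈ Rg L, ∑ l' ∈ (Rg L).filter (fun l' => l' / (d * Q) = l / (d * Q)),
      ‖∑ m ∈ Rg M, Gf γ k N d a (l * m) * (starRingEnd ℂ) (Gf γ k N d a (l' * m))‖
        ≤ (4 + C) * (M / d) := by
    intro l hl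
    have each : ∀ l' ∈ (Rg L).filter (fun l' => l' / (d * Q) = l / (d * Q)),
        ‖∑ m ∈ Rg M, Gf γ k N d a (l * m) * (starRingEnd ℂ) (Gf γ k N d a (l' * m))‖
        ≤ (if l' = l then 4 * (M / d) else 0) +
          (if l' ≡ l [MOD d] then C * (M / d / P) else 0) := by
      intro l' hl'
      rw [mem_filter] at hl'
      rw [E_eq]
      set s := (Rg M).filter (fun x => (N < ((l * x : ℕ) : ℝ) ∧ ((l * x : ℕ) : ℝ) ≤ 2 * N ∧
        (d : ℤ) ∣ ((l * x : ℕ) : ℤ) - a) ∧ (N < ((l' * x : ℕ) : ℝ) ∧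
        ((l' * x : ℕ) : ℝ) ≤ 2 * N ∧ (d : ℤ) ∣ ((l' * x : ℕ) : ℤ) - a)) with hs
      have hAP : IsAP d s := by
        apply isAP_filter ha N l l' ⌈M⌉₊ ⌊4 * M⌋₊ s
        intro x
        rw [hs, mem_filter]
        rfl
      have hr : ∀ x ∈ s, M ≤ (x : ℝ) ∧ (x : ℝ) ≤ 4 * M := by
        intro x hx
        exact (mem_Rg hM.le).1 (mem_filter.1 hx).1
      have hCp : 0 ≤ C * (M / d / P) := by positivity
      by_cases hll : l' = l
      · rw [if_pos hll]
        have h1 : ‖∑ m ∈ s, e (k * ((l : ℝ) ^ γ - (l' : ℝ) ^ γ) * (m : ℝ) ^ γ)‖ ≤ 4 * (M / d) :=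
          (norm_sum_le_card s _).trans (hAP.card_le hd M hr hdM)
        have h2 : 0 ≤ (if l' ≡ l [MOD d] then C * (M / d / P) else 0) := by
          split_ifs <;> simp [hCp]
        linarith
      · rw [if_neg hll, zero_add]
        by_cases hm : l' ≡ l [MOD d]
        · rw [if_pos hm]
          exact key l hl l' hl'.1 s hAP hr (Ne.symm hll) hl'.2 hm
        · rw [if_neg hm]
          have : s = ∅ := by
            rw [eq_empty_iff_forall_notMem]
            intro x hx
            have := (mem_filter.1 hx).2
            exact hm (modEq_of_both ha this.1.2.2 this.2.2.2)
          rw [this]; simp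
    refine (sum_le_sum each).trans ?_
    rw [sum_add_distrib]
    have s1 : ∑ l' ∈ (Rg L).filter (fun l' => l' / (d * Q) = l / (d * Q)),
        (if l' = l then 4 * (M / d) else 0) ≤ 4 * (M / d) := by
      rw [sum_ite_eq']
      split_ifs
      · exact le_rfl
      · positivity
    have s2 : ∑ l' ∈ (Rg L).filter (fun l' => l' / (d * Q) = l / (d * Q)),
        (if l' ≡ l [MOD d] then C * (M / d / P) else 0) ≤ C * (M / d) := by
      rw [← sum_filter, filter_filter, sum_const, nsmul_eq_mul]
      have h1 := card_block (Rg L) d Q (l / (d * Q)) l hQ1 hd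
      have h2 : (((Rg L).filter (fun l' => l' / (d * Q) = l / (d * Q) ∧ l' ≡ l [MOD d])).card : ℝ)
          ≤ P := le_trans (by exact_mod_cast h1) hQP
      calc _ ≤ P * (C * (M / d / P)) := by gcongr
        _ = _ := by field_simp
    linarith
  have hnb : (((Rg L).image (fun l => l / (d * Q))).card : ℝ) ≤ 12 * (L / (d * P)) := by
    have h1 : ((Rg L).image (fun l => l / (d * Q))) ⊆ range (⌊4 * L / (d * Q)⌋₊ + 1) := by
      intro b hb
      rw [mem_image] at hb
      obtain ⟨l, hl, rfl⟩ := hb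
      rw [mem_Rg hL.le] at hl
      rw [mem_range, Nat.lt_succ_iff]
      apply Nat.le_floor
      refine Nat.cast_div_le.trans ?_
      push_cast
      gcongr
      exact hl.2
    have h2 := card_le_card h1
    rw [card_range] at h2
    have h3 : ((⌊4 * L / (d * Q)⌋₊ : ℕ) : ℝ) ≤ 4 * L / (d * Q) := Nat.floor_le (by positivity)
    have h4 : (((Rg L).image (fun l => l / (d * Q))).card : ℝ) ≤ (⌊4 * L / (d * Q)⌋₊ : ℕ) + 1 := by
      exact_mod_cast h2
    have h5 : 4 * L / (d * Q) ≤ 8 * (L / (d * P)) := by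
      rw [← mul_div_assoc, div_le_div_iff₀ (by positivity) (by positivity)]
      have : (d : ℝ) * P ≤ d * (2 * Q) := by gcongr
      nlinarith
    have h6 : 1 ≤ 4 * (L / (d * P)) := by
      rw [← mul_div_assoc, le_div_iff₀ (by positivity)]
      linarith
    linarith
  have := bilinear (Rg L) (Rg M) β α (fun l m => Gf γ k N d a (l * m)) (fun l => l / (d * Q))
    (12 * (L / (d * P))) ((4 + C) * (M / d)) hnb hB
  refine this.trans (le_of_eq ?_)
  ring

end PS

namespace PS
open Finset

lemma Gf_eq_zero {γ k N : ℝ} {d : ℕ} {a : ℤ} {n : ℕ} (h : ¬ (N < (n : ℝ) ∧ (n : ℝ) ≤ 2 * N)) :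
    Gf γ k N d a n = 0 := by
  unfold Gf
  exact if_neg (fun h' => h ⟨h'.1, h'.2.1⟩)

lemma typeI (γ : ℝ) (h0 : 0 < γ) (hγ1 : γ < 1) : ∃ C, 1 ≤ C ∧
    ∀ (N k P : ℝ) (d l Y : ℕ) (a : ℤ), 0 < N → 1 ≤ d → 1 ≤ P → 1 ≤ l → Int.gcd (d : ℤ) a = 1 →
    P ^ 2 ≤ |k| * N ^ γ → |k| * N ^ γ * P ^ 6 ≤ (N / l / d) ^ 3 → P ^ 6 ≤ N / l / d →
    ‖∑ m ∈ Icc 1 Y, Gf γ k N d a (l * m)‖ ≤ C * (N / l / d / P) ∧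
    ‖∑ m ∈ Icc 1 Y, ((Real.log m : ℝ) : ℂ) * Gf γ k N d a (l * m)‖
      ≤ 2 * Real.log (4 * (N / l)) * (C * (N / l / d / P)) := by
  classical
  obtain ⟨C, hC1, hC⟩ := expSum_set γ h0 hγ1
  refine ⟨C, hC1, ?_⟩
  intro N k P d l Y a hN hd hP hl ha hT1 hT2 hJ
  have hl' : (1 : ℝ) ≤ l := by exact_mod_cast hl
  set s := (Icc 1 Y).filter (fun x => N < ((l * x : ℕ) : ℝ) ∧ ((l * x : ℕ) : ℝ) ≤ 2 * N ∧
      (d : ℤ) ∣ ((l * x : ℕ) : ℤ) - a) with hs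
  have hAP : IsAP d s := by
    apply isAP_filter ha N l l 1 Y s
    intro x
    rw [hs, mem_filter]
    tauto
  have hr : ∀ x ∈ s, N / l ≤ (x : ℝ) ∧ (x : ℝ) ≤ 4 * (N / l) := by
    intro x hx
    have h := (mem_filter.1 hx).2
    push_cast at h
    constructor
    · rw [div_le_iff₀ (by positivity)]
      linarith [h.1]
    · rw [← mul_div_assoc, le_div_iff₀ (by positivity)]
      linarith [h.2.1]
  have hc : |k * (l : ℝ) ^ γ| * (N / l) ^ γ = |k| * N ^ γ := by
    rw [abs_mul, abs_of_nonneg (show 0 ≤ (l : ℝ) ^ γ by positivity), mul_assoc,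
      ← Real.mul_rpow (by positivity) (by positivity), mul_div_cancel₀ _ (by positivity)]
  have hG : ∀ m : ℕ, Gf γ k N d a (l * m) = if (N < ((l * m : ℕ) : ℝ) ∧
      ((l * m : ℕ) : ℝ) ≤ 2 * N ∧ (d : ℤ) ∣ ((l * m : ℕ) : ℤ) - a) then
        e (k * (l : ℝ) ^ γ * (m : ℝ) ^ γ) else 0 := by
    intro m
    unfold Gf
    push_cast
    rw [Real.mul_rpow (by positivity) (by positivity), mul_assoc]
  obtain ⟨r1, r2⟩ := hC (k * (l : ℝ) ^ γ) (N / l) P d s (by positivity) hd hP hAP hr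
    (by rw [hc]; exact hT1) (by rw [hc]; exact hT2) hJ
  constructor
  · refine le_trans (le_of_eq ?_) r1
    congr 1
    rw [hs, sum_filter]
    exact sum_congr rfl fun m _ => hG m
  · refine le_trans (le_of_eq ?_) r2
    congr 1
    rw [hs, sum_filter]
    refine sum_congr rfl fun m _ => ?_
    rw [hG m]
    split_ifs <;> simp

lemma conv_sum (f g : ArithmeticFunction ℝ) (G : ℕ → ℂ) (Y : ℕ) (hG : ∀ n, Y < n → G n = 0) :
    ∑ n ∈ Icc 1 Y, (((f * g) n : ℝ) : ℂ) * G n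
      = ∑ l ∈ Icc 1 Y, ∑ m ∈ Icc 1 Y, (f l : ℂ) * (g m : ℂ) * G (l * m) := by
  classical
  rw [← sum_product' (f := fun l m => (f l : ℂ) * (g m : ℂ) * G (l * m))]
  have h1 : ∑ x ∈ Icc 1 Y ×ˢ Icc 1 Y, (f x.1 : ℂ) * (g x.2 : ℂ) * G (x.1 * x.2)
      = ∑ x ∈ (Icc 1 Y ×ˢ Icc 1 Y).filter (fun x => x.1 * x.2 ∈ Icc 1 Y),
        (f x.1 : ℂ) * (g x.2 : ℂ) * G (x.1 * x.2) := by
    rw [sum_filter]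
    apply sum_congr rfl
    intro x hx
    rw [mem_product, mem_Icc, mem_Icc] at hx
    split_ifs with h
    · rfl
    · rw [hG, mul_zero]
      rw [mem_Icc] at h
      have : 0 < x.1 * x.2 := Nat.mul_pos (by omega) (by omega)
      omega
  rw [h1, ← sum_fiberwise_of_maps_to (t := Icc 1 Y) (g := fun x : ℕ × ℕ => x.1 * x.2)
    (fun x hx => (mem_filter.1 hx).2)]
  apply sum_congr rfl
  intro n hn
  rw [ArithmeticFunction.mul_apply]
  push_cast
  rw [sum_mul]
  have hset : n.divisorsAntidiagonal = ((Icc 1 Y ×ˢ Icc 1 Y).filter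
      (fun x => x.1 * x.2 ∈ Icc 1 Y)).filter (fun x => x.1 * x.2 = n) := by
    ext ⟨x, y⟩
    rw [mem_Icc] at hn
    simp only [Nat.mem_divisorsAntidiagonal, mem_filter, mem_product, mem_Icc]
    constructor
    · rintro ⟨h, hne⟩
      have hx : 0 < x := Nat.pos_of_ne_zero (by rintro rfl; simp at h; omega)
      have hy : 0 < y := Nat.pos_of_ne_zero (by rintro rfl; simp at h; omega)
      have := Nat.le_mul_of_pos_right x hy
      have := Nat.le_mul_of_pos_left y hx
      omega
    · rintro ⟨_, h⟩
      exact ⟨h, by omega⟩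
  rw [← hset]
  apply sum_congr rfl
  intro x hx
  rw [(Nat.mem_divisorsAntidiagonal.1 hx).1]

/-- box lemma with `L²` bounds inserted -/
lemma box2 (γ : ℝ) (h0 : 1 / 2 ≤ γ) (hγ1 : γ < 1) : ∃ C, 1 ≤ C ∧
    ∀ (N k P L M Lg : ℝ) (d : ℕ) (a : ℤ) (β α : ℕ → ℝ), 0 < L → 0 < M → M * L = N / 2 →
    1 ≤ d → 1 ≤ P → Int.gcd (d : ℤ) a = 1 → d * P ≤ 4 * L → L ≤ √N → 0 ≤ Lg →
    16 * P ^ 2 * √N ≤ |k| * N ^ γ → 8 * (|k| * N ^ γ) * d ^ 4 * P ^ 7 ≤ N ^ 2 →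
    2 * P ^ 6 * d ≤ √N →
    (∑ m ∈ Rg M, α m ^ 2) ≤ 4 * M * Lg ^ 3 → (∑ l ∈ Rg L, β l ^ 2) ≤ 4 * L * Lg ^ 3 →
    ‖∑ l ∈ Rg L, ∑ m ∈ Rg M, (β l : ℂ) * (α m : ℂ) * Gf γ k N d a (l * m)‖
      ≤ C * Lg ^ 3 * (N / (d * √P)) := by
  obtain ⟨C, hC1, hC⟩ := box γ h0 hγ1
  refine ⟨2 * C, by linarith, ?_⟩
  intro N k P L M Lg d a β α hL hM hML hd hP ha hdP hLN hLg h3 h4 h5 hα hβ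
  have hd' : (1 : ℝ) ≤ d := by exact_mod_cast hd
  have hN : 0 < N := by nlinarith [mul_pos hM hL]
  have hs : √N * √N = N := Real.mul_self_sqrt hN.le
  have hs0 : 0 < √N := Real.sqrt_pos.2 hN
  have hMe : M = N / (2 * L) := by field_simp; linarith
  have hT0 : 0 ≤ |k| * N ^ γ := by positivity
  set T := |k| * N ^ γ with hT
  have hPpos : 0 < P := by linarith
  have hL2 : L ^ 2 ≤ N := by nlinarith
  have c1 : P ^ 2 ≤ T * d / (16 * L) := by
    rw [le_div_iff₀ (by positivity)]
    calc P ^ 2 * (16 * L) ≤ P ^ 2 * (16 * √N) := by gcongr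
      _ ≤ T := by linarith
      _ ≤ T * d := le_mul_of_one_le_right hT0 hd'
  have c2 : T * (d * P / L) * P ^ 6 ≤ (M / d) ^ 3 := by
    rw [hMe, div_div, div_pow, le_div_iff₀ (by positivity)]
    have : T * (d * P / L) * P ^ 6 * (2 * L * d) ^ 3 = (8 * T * d ^ 4 * P ^ 7) * L ^ 2 := by
      field_simp; ring
    rw [this]
    calc _ ≤ N ^ 2 * N := by gcongr
      _ = _ := by ring
  have c3 : P ^ 6 ≤ M / d := by
    rw [hMe, div_div, le_div_iff₀ (by positivity)]
    calc P ^ 6 * (2 * L * d) = (2 * P ^ 6 * d) * L := by ring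
      _ ≤ √N * √N := by gcongr
      _ = N := hs
  have key := hC N k P L M d a β α hL hM hML hd hP ha hdP c1 c2 c3
  have hsP : √P * √P = P := Real.mul_self_sqrt hPpos.le
  have hsP0 : 0 < √P := Real.sqrt_pos.2 hPpos
  apply le_of_sq_le_sq _ (by positivity)
  refine key.trans ?_
  calc _ ≤ C * (4 * M * Lg ^ 3) * (4 * L * Lg ^ 3) * (L / (d * P)) * (M / d) := by
        gcongr
    _ = 16 * C * Lg ^ 6 * (M * L) ^ 2 / (d ^ 2 * P) := by field_simp; ring
    _ = 4 * C * Lg ^ 6 * N ^ 2 / (d ^ 2 * P) := by rw [hML]; ring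
    _ ≤ 4 * C ^ 2 * Lg ^ 6 * N ^ 2 / (d ^ 2 * P) := by
        gcongr
        nlinarith
    _ = _ := by
        nth_rw 1 [← hsP]
        field_simp
        ring

end PS

namespace PS
open Finset

lemma sum_eq_of_support {s t : Finset ℕ} {f : ℕ → ℂ} (h : ∀ x ∈ s, x ∉ t → f x = 0)
    (h' : ∀ x ∈ t, x ∉ s → f x = 0) : ∑ x ∈ s, f x = ∑ x ∈ t, f x := by
  rw [← sum_subset (inter_subset_left (s₁ := s) (s₂ := t)),
    ← sum_subset (inter_subset_right (s₁ := s) (s₂ := t))]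
  · intro x hx hn
    exact h' x hx (fun h1 => hn (mem_inter.2 ⟨h1, hx⟩))
  · intro x hx hn
    exact h x hx (fun h1 => hn (mem_inter.2 ⟨hx, h1⟩))

lemma sum_Rg_le {M : ℝ} (hM : 0 < M) (f g : ℕ → ℝ) (h : ∀ n, g n ^ 2 ≤ f n ^ 2) :
    ∑ n ∈ Rg M, g n ^ 2 ≤ ∑ n ∈ Icc 1 ⌊4 * M⌋₊, f n ^ 2 := by
  refine (sum_le_sum fun n _ => h n).trans ?_
  apply sum_le_sum_of_subset_of_nonneg
  · intro x hx
    unfold Rg at hx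
    rw [mem_Icc] at *
    exact ⟨(Nat.one_le_ceil_iff.2 hM).trans hx.1, hx.2⟩
  · intro _ _ _; positivity

lemma typeII (γ : ℝ) (h0 : 1 / 2 ≤ γ) (hγ1 : γ < 1) : ∃ C, 1 ≤ C ∧
    ∀ (N k P Lg : ℝ) (d : ℕ) (a : ℤ) (f g : ℕ → ℝ), 1 ≤ N → 1 ≤ d → 1 ≤ P →
    Int.gcd (d : ℤ) a = 1 → 0 ≤ Lg →
    16 * P ^ 2 * √N ≤ |k| * N ^ γ → 8 * (|k| * N ^ γ) * d ^ 4 * P ^ 7 ≤ N ^ 2 →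
    2 * P ^ 6 * d ≤ √N →
    (∀ n : ℕ, (n : ℝ) ≤ d * P → f n = 0) → (∀ n : ℕ, (n : ℝ) ≤ d * P → g n = 0) →
    (∀ x : ℝ, 0 ≤ x → x ≤ 8 * N → ∑ n ∈ Icc 1 ⌊x⌋₊, f n ^ 2 ≤ x * Lg ^ 3) →
    (∀ x : ℝ, 0 ≤ x → x ≤ 8 * N → ∑ n ∈ Icc 1 ⌊x⌋₊, g n ^ 2 ≤ x * Lg ^ 3) →
    ‖∑ l ∈ Icc 1 ⌊2 * N⌋₊, ∑ m ∈ Icc 1 ⌊2 * N⌋₊, (f l : ℂ) * (g m : ℂ) * Gf γ k N d a (l * m)‖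
      ≤ (Nat.log 2 ⌊2 * N⌋₊ + 1) * (C * Lg ^ 3 * (N / (d * √P))) := by
  classical
  obtain ⟨C, hC1, hC⟩ := box2 γ h0 hγ1
  refine ⟨C, hC1, ?_⟩
  intro N k P Lg d a f g hN hd hP ha hLg h3 h4 h5 hf hg hf2 hg2
  set Y := ⌊2 * N⌋₊ with hY
  have hd' : (1 : ℝ) ≤ d := by exact_mod_cast hd
  have hY2 : (Y : ℝ) ≤ 2 * N := Nat.floor_le (by linarith)
  have hYne : Y ≠ 0 := by
    have : 1 ≤ Y := (Nat.one_le_floor_iff _).2 (by linarith)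
    omega
  have hmaps : ∀ l ∈ Icc 1 Y, Nat.log 2 l ∈ range (Nat.log 2 Y + 1) := by
    intro l hl
    rw [mem_Icc] at hl
    rw [mem_range, Nat.lt_succ_iff]
    exact Nat.log_mono_right hl.2
  rw [← sum_fiberwise_of_maps_to hmaps]
  refine (norm_sum_le _ _).trans ?_
  have hbd : 0 ≤ C * Lg ^ 3 * (N / (d * √P)) := by positivity
  suffices hi : ∀ i ∈ range (Nat.log 2 Y + 1),
      ‖∑ l ∈ (Icc 1 Y).filter (fun l => Nat.log 2 l = i), ∑ m ∈ Icc 1 Y,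
        (f l : ℂ) * (g m : ℂ) * Gf γ k N d a (l * m)‖ ≤ C * Lg ^ 3 * (N / (d * √P)) by
    refine (sum_le_sum hi).trans (le_of_eq ?_)
    rw [sum_const, card_range, nsmul_eq_mul]
    push_cast
    ring
  intro i hi
  rw [mem_range, Nat.lt_succ_iff] at hi
  set Fi := (Icc 1 Y).filter (fun l => Nat.log 2 l = i) with hFi
  set L : ℝ := 2 ^ i with hLdef
  have hL1 : 1 ≤ L := one_le_pow₀ (by norm_num)
  have hL0 : 0 < L := by linarith
  set M : ℝ := N / (2 * L) with hMdef
  have hM0 : 0 < M := by positivity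
  have hML : M * L = N / 2 := by rw [hMdef]; field_simp
  have hLY : L ≤ 2 * N := by
    refine le_trans ?_ hY2
    have h1 : 2 ^ i ≤ Y := (Nat.pow_le_pow_right (by norm_num) hi).trans
      (Nat.pow_log_le_self 2 hYne)
    rw [hLdef]
    exact_mod_cast h1
  have hFiL : ∀ l ∈ Fi, L ≤ (l : ℝ) ∧ (l : ℝ) ≤ 2 * L := by
    intro l hl
    obtain ⟨h1, h2⟩ := mem_filter.1 hl
    rw [mem_Icc] at h1
    have a1 : 2 ^ i ≤ l := by rw [← h2]; exact Nat.pow_log_le_self 2 (by omega)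
    have a2 : l < 2 ^ (i + 1) := by rw [← h2]; exact Nat.lt_pow_succ_log_self (by norm_num) l
    constructor
    · rw [hLdef]; exact_mod_cast a1
    · have : (l : ℝ) < 2 ^ (i + 1) := by exact_mod_cast a2
      rw [hLdef]
      rw [pow_succ] at this
      linarith
  set β : ℕ → ℝ := fun l => if l ∈ Fi then f l else 0 with hβ
  have hFiR : Fi ⊆ Rg L := by
    intro l hl
    rw [mem_Rg hL0.le]
    have := hFiL l hl
    exact ⟨this.1, by linarith [this.2]⟩
  have heq : ∑ l ∈ Fi, ∑ m ∈ Icc 1 Y, (f l : ℂ) * (g m : ℂ) * Gf γ k N d a (l * m)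
      = ∑ l ∈ Rg L, ∑ m ∈ Rg M, (β l : ℂ) * (g m : ℂ) * Gf γ k N d a (l * m) := by
    rw [← sum_subset hFiR]
    · apply sum_congr rfl
      intro l hl
      have : β l = f l := if_pos hl
      rw [this]
      have hl1 := hFiL l hl
      apply sum_eq_of_support
      · intro m hm hn
        rw [Gf_eq_zero, mul_zero]
        rintro ⟨b1, b2⟩
        apply hn
        rw [mem_Rg hM0.le]
        push_cast at b1 b2
        have hm0 : (0 : ℝ) ≤ m := by positivity
        constructor
        · rw [hMdef, div_le_iff₀ (by positivity)]
          nlinarith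
        · rw [hMdef, ← mul_div_assoc, le_div_iff₀ (by positivity)]
          nlinarith
      · intro m hm hn
        rw [Gf_eq_zero, mul_zero]
        rintro ⟨b1, b2⟩
        apply hn
        rw [mem_Icc]
        push_cast at b1 b2
        have hm1 : 1 ≤ m := by
          rcases Nat.eq_zero_or_pos m with h | h
          · subst h
            simp at b1
            linarith
          · exact h
        refine ⟨hm1, Nat.le_floor ?_⟩
        have hm0 : (0 : ℝ) ≤ m := by positivity
        nlinarith
    · intro l _ hl
      apply sum_eq_zero
      intro m _
      have : β l = 0 := if_neg hl
      rw [this]; simp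
  rw [heq]
  have hM4 : 4 * M ≤ 8 * N := by
    rw [hMdef, ← mul_div_assoc, div_le_iff₀ (by positivity)]
    nlinarith
  have sα : ∑ m ∈ Rg M, g m ^ 2 ≤ 4 * M * Lg ^ 3 :=
    (sum_Rg_le hM0 g g fun _ => le_rfl).trans (hg2 _ (by positivity) hM4)
  have sβ : ∑ m ∈ Rg L, β m ^ 2 ≤ 4 * L * Lg ^ 3 := by
    refine (sum_Rg_le hL0 f β fun n => ?_).trans (hf2 _ (by positivity) (by linarith))
    simp only [hβ]
    split_ifs
    · exact le_rfl
    · rw [zero_pow two_ne_zero]; positivity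
  rcases le_or_gt L (√N) with hLN | hLN
  · by_cases hex : ∃ l ∈ Fi, d * P < (l : ℝ)
    · obtain ⟨l, hl, hl2⟩ := hex
      have := hFiL l hl
      exact hC N k P L M Lg d a β g hL0 hM0 hML hd hP ha (by linarith) hLN hLg h3 h4 h5 sα sβ
    · push Not at hex
      have hz : ∀ l, β l = 0 := by
        intro l
        simp only [hβ]
        split_ifs with h
        · exact hf l (hex l h)
        · rfl
      simp [hz, hbd]
  · have hMN : M ≤ √N := by
      have hs : √N * √N = N := Real.mul_self_sqrt (by linarith)
      rw [hMdef, div_le_iff₀ (by positivity)]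
      nlinarith [Real.sqrt_nonneg N]
    by_cases hex : ∃ m ∈ Rg M, d * P < (m : ℝ)
    · obtain ⟨m, hm, hm2⟩ := hex
      rw [mem_Rg hM0.le] at hm
      have := hC N k P M L Lg d a g β hM0 hL0 (by linarith) hd hP ha (by linarith) hMN hLg h3 h4 h5
        sβ sα
      refine le_trans (le_of_eq ?_) this
      congr 1
      rw [sum_comm]
      refine sum_congr rfl fun m _ => sum_congr rfl fun l _ => ?_
      rw [mul_comm l m]; ring
    · push Not at hex
      have hz : ∑ l ∈ Rg L, ∑ m ∈ Rg M, (β l : ℂ) * (g m : ℂ) * Gf γ k N d a (l * m) = 0 := by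
        refine sum_eq_zero fun l _ => sum_eq_zero fun m hm => ?_
        rw [hg m (hex m hm)]; simp
      rw [hz, norm_zero]; exact hbd

/-- harmonic sums -/
lemma harm_le (Y : ℕ) (x : ℝ) (hx : 1 ≤ x) (hY : (Y : ℝ) ≤ x) :
    ∑ n ∈ Icc 1 Y, (1 / (n : ℝ)) ≤ 1 + Real.log x := by
  have h := harmonic_le_one_add_log Y
  rw [harmonic_eq_sum_Icc] at h
  push_cast at h
  simp only [one_div]
  refine h.trans ?_
  rcases Nat.eq_zero_or_pos Y with h0 | h0
  · subst h0
    simp [Real.log_nonneg hx]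
  · gcongr

lemma count_mul (Y q : ℕ) (x : ℝ) (hq : 1 ≤ q) (hY : (Y : ℝ) ≤ x) :
    (((Icc 1 Y).filter (fun n => q ∣ n)).card : ℝ) ≤ x / q := by
  have : (Icc 1 Y).filter (fun n => q ∣ n) = (Ioc 0 Y).filter (fun n => q ∣ n) := by
    ext n; simp only [mem_filter, mem_Icc, mem_Ioc]; omega
  rw [this, Nat.Ioc_filter_dvd_card_eq_div]
  refine Nat.cast_div_le.trans ?_
  gcongr

lemma tau_sq (x : ℝ) (hx : 1 ≤ x) :
    ∑ n ∈ Icc 1 ⌊x⌋₊, (n.divisors.card : ℝ) ^ 2 ≤ x * (1 + Real.log x) ^ 3 := by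
  classical
  set Y := ⌊x⌋₊ with hY
  have hYx : (Y : ℝ) ≤ x := Nat.floor_le (by linarith)
  set T := Icc 1 Y ×ˢ (Icc 1 Y ×ˢ Icc 1 Y) with hT
  have h1 : ∀ n ∈ Icc 1 Y, n.divisors.card ^ 2
      ≤ (T.filter (fun p => p.1 * (p.2.1 * p.2.2) ∣ n)).card := by
    intro n hn
    rw [mem_Icc] at hn
    rw [sq, ← card_product]
    apply card_le_card_of_injOn
      (fun p : ℕ × ℕ => (p.1.gcd p.2, (p.1 / p.1.gcd p.2, p.2 / p.1.gcd p.2)))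
    · rintro ⟨u, v⟩ huv
      simp only [coe_product, Set.mem_prod, mem_coe, Nat.mem_divisors] at huv
      obtain ⟨⟨hu, _⟩, ⟨hv, _⟩⟩ := huv
      have hu0 : 0 < u := Nat.pos_of_dvd_of_pos hu (by omega)
      have hv0 : 0 < v := Nat.pos_of_dvd_of_pos hv (by omega)
      have hun := Nat.le_of_dvd (by omega) hu
      have hvn := Nat.le_of_dvd (by omega) hv
      have hg0 : 0 < u.gcd v := Nat.gcd_pos_of_pos_left _ hu0
      have hgu := Nat.le_of_dvd hu0 (Nat.gcd_dvd_left u v)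
      have hgv := Nat.le_of_dvd hv0 (Nat.gcd_dvd_right u v)
      have a1 := Nat.div_pos hgu hg0
      have a2 := Nat.div_pos hgv hg0
      have a3 := Nat.div_le_self u (u.gcd v)
      have a4 := Nat.div_le_self v (u.gcd v)
      rw [mem_coe, mem_filter, hT]
      simp only [mem_product, mem_Icc]
      refine ⟨⟨by omega, by omega, by omega⟩, ?_⟩
      rw [← mul_assoc, Nat.mul_div_cancel' (Nat.gcd_dvd_left u v),
        ← Nat.mul_div_assoc _ (Nat.gcd_dvd_right u v)]
      exact Nat.lcm_dvd hu hv
    · rintro ⟨u, v⟩ huv ⟨u', v'⟩ huv' heq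
      simp only [Prod.mk.injEq] at heq
      obtain ⟨g1, g2, g3⟩ := heq
      have e1 : u = u' := by
        rw [← Nat.mul_div_cancel' (Nat.gcd_dvd_left u v), g2, g1,
          Nat.mul_div_cancel' (Nat.gcd_dvd_left u' v')]
      have e2 : v = v' := by
        rw [← Nat.mul_div_cancel' (Nat.gcd_dvd_right u v), g3, g1,
          Nat.mul_div_cancel' (Nat.gcd_dvd_right u' v')]
      rw [e1, e2]
  calc ∑ n ∈ Icc 1 Y, (n.divisors.card : ℝ) ^ 2
      ≤ ∑ n ∈ Icc 1 Y, ((T.filter (fun p => p.1 * (p.2.1 * p.2.2) ∣ n)).card : ℝ) := by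
        apply sum_le_sum
        intro n hn
        exact_mod_cast h1 n hn
    _ = ∑ p ∈ T, (((Icc 1 Y).filter (fun n => p.1 * (p.2.1 * p.2.2) ∣ n)).card : ℝ) := by
        have := sum_card_bipartiteAbove_eq_sum_card_bipartiteBelow
          (s := Icc 1 Y) (t := T) (fun (n : ℕ) (p : ℕ × ℕ × ℕ) => p.1 * (p.2.1 * p.2.2) ∣ n)
        unfold bipartiteAbove bipartiteBelow at this
        exact_mod_cast this
    _ ≤ ∑ p ∈ T, x * ((1 / (p.1 : ℝ)) * ((1 / (p.2.1 : ℝ)) * (1 / (p.2.2 : ℝ)))) := by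
        apply sum_le_sum
        intro p hp
        rw [hT] at hp
        simp only [mem_product, mem_Icc] at hp
        have h1 : 1 ≤ p.1 * (p.2.1 * p.2.2) :=
          Nat.mul_pos hp.1.1 (Nat.mul_pos hp.2.1.1 hp.2.2.1)
        refine (count_mul Y _ x h1 hYx).trans (le_of_eq ?_)
        push_cast
        rw [one_div_mul_one_div, one_div_mul_one_div, mul_one_div]
    _ = x * (∑ n ∈ Icc 1 Y, (1 / (n : ℝ))) ^ 3 := by
        rw [← mul_sum, hT, sum_product]
        simp only [sum_product, ← mul_sum, ← sum_mul]
        ring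
    _ ≤ _ := by
        have h0 : 0 ≤ ∑ n ∈ Icc 1 Y, (1 / (n : ℝ)) := sum_nonneg fun _ _ => by positivity
        gcongr
        exact harm_le Y x hx hYx

end PS

namespace PS
open Finset ArithmeticFunction

/-- truncation to `n ≤ U` -/
noncomputable def lo (U : ℝ) (f : ArithmeticFunction ℝ) : ArithmeticFunction ℝ :=
  open scoped Classical in ⟨fun n => if (n : ℝ) ≤ U then f n else 0, by simp⟩

/-- truncation to `n > U` -/
noncomputable def hi (U : ℝ) (f : ArithmeticFunction ℝ) : ArithmeticFunction ℝ := f - lo U f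

lemma lo_of_le {U : ℝ} {f : ArithmeticFunction ℝ} {n : ℕ} (h : (n : ℝ) ≤ U) :
    lo U f n = f n := if_pos h
lemma lo_of_gt {U : ℝ} {f : ArithmeticFunction ℝ} {n : ℕ} (h : U < (n : ℝ)) :
    lo U f n = 0 := if_neg (not_le.2 h)
lemma hi_apply {U : ℝ} {f : ArithmeticFunction ℝ} {n : ℕ} : hi U f n = f n - lo U f n := rfl
lemma hi_of_le {U : ℝ} {f : ArithmeticFunction ℝ} {n : ℕ} (h : (n : ℝ) ≤ U) :
    hi U f n = 0 := by rw [hi_apply, lo_of_le h, sub_self]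
lemma hi_of_gt {U : ℝ} {f : ArithmeticFunction ℝ} {n : ℕ} (h : U < (n : ℝ)) :
    hi U f n = f n := by rw [hi_apply, lo_of_gt h, sub_zero]
lemma abs_lo_le (U : ℝ) (f : ArithmeticFunction ℝ) (n : ℕ) : |lo U f n| ≤ |f n| := by
  rcases le_or_gt (n : ℝ) U with h | h
  · rw [lo_of_le h]
  · rw [lo_of_gt h]; simp
lemma abs_hi_le (U : ℝ) (f : ArithmeticFunction ℝ) (n : ℕ) : |hi U f n| ≤ |f n| := by
  rcases le_or_gt (n : ℝ) U with h | h
  · rw [hi_of_le h]; simp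
  · rw [hi_of_gt h]

/-- real Möbius -/
noncomputable def mu : ArithmeticFunction ℝ := ((ArithmeticFunction.moebius : ArithmeticFunction ℤ) : ArithmeticFunction ℝ)
/-- real zeta -/
noncomputable def ze : ArithmeticFunction ℝ := ((ArithmeticFunction.zeta : ArithmeticFunction ℕ) : ArithmeticFunction ℝ)

lemma mu_mul_ze : mu * ze = 1 := ArithmeticFunction.coe_moebius_mul_coe_zeta
lemma vM_mul_ze : vonMangoldt * ze = ArithmeticFunction.log := ArithmeticFunction.vonMangoldt_mul_zeta
lemma abs_mu_le (n : ℕ) : |mu n| ≤ 1 := by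
  unfold mu
  rw [ArithmeticFunction.intCoe_apply]
  have := ArithmeticFunction.abs_moebius_le_one (n := n)
  exact_mod_cast this
lemma ze_apply (n : ℕ) (h : n ≠ 0) : ze n = 1 := by
  unfold ze
  rw [ArithmeticFunction.natCoe_apply, ArithmeticFunction.zeta_apply_ne h]; simp

/-- the type I/II convolution coefficient -/
noncomputable def cc (U : ℝ) : ArithmeticFunction ℝ := lo U mu * lo U vonMangoldt

lemma vaughan (U : ℝ) : (vonMangoldt : ArithmeticFunction ℝ) = lo U vonMangoldt
    + lo U mu * ArithmeticFunction.log - lo U (cc U) * ze - hi U (cc U) * ze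
    + hi U vonMangoldt * (hi U mu * ze) := by
  have h1 : lo U (cc U) + hi U (cc U) = lo U mu * lo U vonMangoldt := by
    unfold hi; rw [add_sub_cancel]; rfl
  have h2 : hi U mu = mu - lo U mu := rfl
  have h3 : hi U (vonMangoldt : ArithmeticFunction ℝ) = vonMangoldt - lo U vonMangoldt := rfl
  have h4 : lo U (cc U) = lo U mu * lo U vonMangoldt - hi U (cc U) := by rw [← h1]; ring
  rw [h4, h2, h3, ← vM_mul_ze]
  linear_combination (-(vonMangoldt : ArithmeticFunction ℝ) + lo U vonMangoldt) * mu_mul_ze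

lemma abs_cc_le (U : ℝ) (n : ℕ) : |cc U n| ≤ Real.log n := by
  unfold cc
  rw [ArithmeticFunction.mul_apply]
  refine (abs_sum_le_sum_abs _ _).trans ?_
  calc ∑ i ∈ n.divisorsAntidiagonal, |lo U mu i.1 * lo U vonMangoldt i.2|
      ≤ ∑ i ∈ n.divisorsAntidiagonal, vonMangoldt i.2 := by
        apply sum_le_sum
        intro i _
        rw [abs_mul]
        have h1 := (abs_lo_le U mu i.1).trans (abs_mu_le _)
        have h2 := abs_lo_le U vonMangoldt i.2
        rw [abs_of_nonneg (vonMangoldt_nonneg (n := i.2))] at h2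
        calc _ ≤ 1 * vonMangoldt i.2 := mul_le_mul h1 h2 (abs_nonneg _) zero_le_one
          _ = _ := one_mul _
    _ = ∑ i ∈ n.divisors, vonMangoldt i := by
        rw [Nat.sum_divisorsAntidiagonal' (f := fun _ y => vonMangoldt y)]
    _ = _ := vonMangoldt_sum

lemma cc_zero {U : ℝ} (hU : 0 ≤ U) {n : ℕ} (h : U ^ 2 < n) : cc U n = 0 := by
  unfold cc
  rw [ArithmeticFunction.mul_apply]
  apply sum_eq_zero
  intro i hi
  rw [Nat.mem_divisorsAntidiagonal] at hi
  have hn : (n : ℝ) = i.1 * i.2 := by rw [← hi.1]; push_cast; ring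
  rcases le_or_gt (i.1 : ℝ) U with h1 | h1
  · rcases le_or_gt (i.2 : ℝ) U with h2 | h2
    · exfalso
      have : (i.1 : ℝ) * i.2 ≤ U * U := mul_le_mul h1 h2 (by positivity) hU
      nlinarith
    · rw [lo_of_gt h2, mul_zero]
  · rw [lo_of_gt h1, zero_mul]

lemma abs_hmz_le (U : ℝ) (n : ℕ) : |(hi U mu * ze) n| ≤ n.divisors.card := by
  rw [ArithmeticFunction.mul_apply]
  refine (abs_sum_le_sum_abs _ _).trans ?_
  calc ∑ i ∈ n.divisorsAntidiagonal, |hi U mu i.1 * ze i.2|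
      ≤ ∑ i ∈ n.divisorsAntidiagonal, (1 : ℝ) := by
        apply sum_le_sum
        intro i hi'
        rw [Nat.mem_divisorsAntidiagonal] at hi'
        have : i.2 ≠ 0 := by
          intro h; rw [h] at hi'; simp at hi'; omega
        rw [ze_apply _ this, mul_one]
        exact (abs_hi_le U mu i.1).trans (abs_mu_le _)
    _ = _ := by
        rw [Nat.sum_divisorsAntidiagonal (f := fun _ _ => (1 : ℝ))]; simp

lemma hmz_zero {U : ℝ} {n : ℕ} (h : (n : ℝ) ≤ U) : (hi U mu * ze) n = 0 := by
  rw [ArithmeticFunction.mul_apply]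
  apply sum_eq_zero
  intro i hi'
  rw [Nat.mem_divisorsAntidiagonal] at hi'
  have h1 : i.1 ≤ n := Nat.le_of_dvd (by omega) ⟨i.2, hi'.1.symm⟩
  have h2 : (i.1 : ℝ) ≤ n := by exact_mod_cast h1
  rw [hi_of_le (h2.trans h), zero_mul]

/-- `L²` bound from a sup bound -/
lemma l2_of_sup (f : ℕ → ℝ) (N Lg : ℝ) (hLg : 1 ≤ Lg) (hf : ∀ n : ℕ, 1 ≤ n → (n : ℝ) ≤ 8 * N → |f n| ≤ Lg)
    (x : ℝ) (hx : 0 ≤ x) (hxN : x ≤ 8 * N) : ∑ n ∈ Icc 1 ⌊x⌋₊, f n ^ 2 ≤ x * Lg ^ 3 := by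
  have hfl : ((⌊x⌋₊ : ℕ) : ℝ) ≤ x := Nat.floor_le hx
  calc ∑ n ∈ Icc 1 ⌊x⌋₊, f n ^ 2 ≤ ∑ n ∈ Icc 1 ⌊x⌋₊, Lg ^ 3 := by
        apply sum_le_sum
        intro n hn
        rw [mem_Icc] at hn
        have h1 : (n : ℝ) ≤ ⌊x⌋₊ := by exact_mod_cast hn.2
        have := hf n hn.1 (by linarith)
        rw [← sq_abs]
        calc |f n| ^ 2 ≤ Lg ^ 2 := by gcongr
          _ ≤ Lg ^ 3 := pow_le_pow_right₀ hLg (by norm_num)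
    _ = ⌊x⌋₊ * Lg ^ 3 := by rw [sum_const, Nat.card_Icc, nsmul_eq_mul]; simp
    _ ≤ _ := by gcongr

end PS

namespace PS
open Finset ArithmeticFunction

lemma natlog_le (N : ℝ) (hN : 1 ≤ N) :
    ((Nat.log 2 ⌊2 * N⌋₊ : ℕ) : ℝ) + 1 ≤ 2 * (1 + Real.log (8 * N)) := by
  set Y := ⌊2 * N⌋₊ with hY
  have hYne : Y ≠ 0 := by
    have : 1 ≤ Y := (Nat.one_le_floor_iff _).2 (by linarith)
    omega
  have hY2 : (Y : ℝ) ≤ 2 * N := Nat.floor_le (by linarith)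
  have h1 : ((2 : ℝ) ^ (Nat.log 2 Y)) ≤ 8 * N := by
    have : (2 ^ (Nat.log 2 Y) : ℕ) ≤ Y := Nat.pow_log_le_self 2 hYne
    have : ((2 : ℝ) ^ (Nat.log 2 Y)) ≤ Y := by exact_mod_cast this
    linarith
  have h2 := Real.log_le_log (by positivity) h1
  rw [Real.log_pow] at h2
  have h3 := Real.log_two_gt_d9
  have h4 : (0 : ℝ) ≤ (Nat.log 2 Y : ℕ) := by positivity
  nlinarith

/-- summing type I bounds -/
lemma typeI_sum (f : ℕ → ℝ) (I : ℕ → ℂ) (Y : ℕ) (F B Lg : ℝ)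
    (hF : ∀ l ∈ Icc 1 Y, |f l| * ‖I l‖ ≤ F * B * (1 / (l : ℝ))) (hFB : 0 ≤ F * B)
    (hH : ∑ n ∈ Icc 1 Y, (1 / (n : ℝ)) ≤ Lg) :
    ‖∑ l ∈ Icc 1 Y, (f l : ℂ) * I l‖ ≤ F * B * Lg := by
  refine (norm_sum_le _ _).trans ?_
  calc ∑ l ∈ Icc 1 Y, ‖(f l : ℂ) * I l‖ ≤ ∑ l ∈ Icc 1 Y, F * B * (1 / (l : ℝ)) := by
        apply sum_le_sum
        intro l hl
        rw [norm_mul, Complex.norm_real, Real.norm_eq_abs]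
        exact hF l hl
    _ = F * B * ∑ n ∈ Icc 1 Y, (1 / (n : ℝ)) := by rw [mul_sum]
    _ ≤ _ := by gcongr

lemma core (γ : ℝ) (h0 : 1 / 2 ≤ γ) (hγ1 : γ < 1) : ∃ C, 1 ≤ C ∧
    ∀ (N k P : ℝ) (d : ℕ) (a : ℤ), 1 ≤ N → 1 ≤ d → 1 ≤ P → Int.gcd (d : ℤ) a = 1 →
    16 * P ^ 2 * √N ≤ |k| * N ^ γ → 8 * (|k| * N ^ γ) * d ^ 4 * P ^ 7 ≤ N ^ 2 →
    2 * P ^ 6 * d ≤ √N → (d * P) ^ 3 < N →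
    ‖∑ n ∈ Icc 1 ⌊2 * N⌋₊, ((vonMangoldt n : ℝ) : ℂ) * Gf γ k N d a n‖
      ≤ C * (1 + Real.log (8 * N)) ^ 4 * (N / (d * √P)) := by
  obtain ⟨C1, hC1, hI⟩ := typeI γ (by linarith) hγ1
  obtain ⟨C2, hC2, hII⟩ := typeII γ h0 hγ1
  refine ⟨3 * C1 + 4 * C2, by linarith, ?_⟩
  intro N k P d a hN hd hP ha h3 h4 h5 h6
  set Y := ⌊2 * N⌋₊ with hY
  set Lg := 1 + Real.log (8 * N) with hLg
  set B := N / (d * √P) with hB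
  set U : ℝ := d * P with hU
  have hd' : (1 : ℝ) ≤ d := by exact_mod_cast hd
  have hPpos : 0 < P := by linarith
  have hU1 : 1 ≤ U := by rw [hU]; nlinarith
  have hYx : (Y : ℝ) ≤ 2 * N := Nat.floor_le (by linarith)
  have hlog0 : 0 ≤ Real.log (8 * N) := Real.log_nonneg (by linarith)
  have hLg1 : 1 ≤ Lg := by linarith
  have hsN : √N * √N = N := Real.mul_self_sqrt (by linarith)
  have hsN1 : 1 ≤ √N := Real.one_le_sqrt.2 hN
  have hsP : √P * √P = P := Real.mul_self_sqrt (by linarith)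
  have hsP1 : 1 ≤ √P := Real.one_le_sqrt.2 hP
  have hB0 : N / (d * P) ≤ B := by
    rw [hB]
    apply div_le_div_of_nonneg_left (by linarith) (by positivity)
    gcongr
    nlinarith
  have hBpos : 0 ≤ B := by rw [hB]; positivity
  have hU2 : U ^ 2 ≤ N := by
    have : U ^ 2 ≤ U ^ 3 := pow_le_pow_right₀ hU1 (by norm_num)
    linarith
  have hUN : U ≤ √N := by
    apply Real.le_sqrt_of_sq_le hU2
  have hUltN : U < N := by
    have : U ≤ U ^ 3 := le_self_pow₀ hU1 (by norm_num)
    linarith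
  set T := |k| * N ^ γ with hT
  have hT0 : 0 ≤ T := by positivity
  have hT1 : P ^ 2 ≤ T := by
    have : 0 ≤ P ^ 2 := by positivity
    nlinarith
  have hGY : ∀ n, Y < n → Gf γ k N d a n = 0 := by
    intro n hn
    apply Gf_eq_zero
    rintro ⟨_, h⟩
    have := Nat.le_floor h
    omega
  have hGU : ∀ n : ℕ, (n : ℝ) ≤ N → Gf γ k N d a n = 0 := by
    intro n hn
    apply Gf_eq_zero
    rintro ⟨h, _⟩
    linarith
  -- type I conditions
  have cond : ∀ l : ℕ, 1 ≤ l → (l : ℝ) ≤ U →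
      T * P ^ 6 ≤ (N / l / d) ^ 3 ∧ P ^ 6 ≤ N / l / d := by
    intro l hl hlU
    have hl' : (1 : ℝ) ≤ l := by exact_mod_cast hl
    have hlow : N / (U * d) ≤ N / l / d := by
      rw [div_div]
      gcongr
    have hlow0 : 0 ≤ N / (U * d) := by positivity
    constructor
    · refine le_trans ?_ (pow_le_pow_left₀ hlow0 hlow 3)
      rw [div_pow, le_div_iff₀ (by positivity)]
      calc T * P ^ 6 * (U * d) ^ 3 = T * d ^ 4 * P ^ 7 * U ^ 2 := by rw [hU]; ring
        _ ≤ N ^ 2 * N := by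
            apply mul_le_mul _ hU2 (by positivity) (by positivity)
            have : 0 ≤ T * d ^ 4 * P ^ 7 := by positivity
            linarith
        _ = _ := by ring
    · refine le_trans ?_ hlow
      rw [le_div_iff₀ (by positivity)]
      calc P ^ 6 * (U * d) = (P ^ 6 * d) * U := by ring
        _ ≤ √N * √N := by
            apply mul_le_mul _ hUN (by positivity) (by positivity)
            have : 0 ≤ P ^ 6 * d := by positivity
            linarith
        _ = N := hsN
  have hH : ∑ n ∈ Icc 1 Y, (1 / (n : ℝ)) ≤ Lg := harm_le Y (8 * N) (by linarith) (by linarith)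
  have hlogle : ∀ n : ℕ, 1 ≤ n → (n : ℝ) ≤ 8 * N → Real.log n ≤ Lg := by
    intro n hn hn2
    have : Real.log n ≤ Real.log (8 * N) :=
      Real.log_le_log (by exact_mod_cast hn) hn2
    linarith
  have hC10 : 0 ≤ C1 := by linarith
  -- piece 1
  have p1 : ∑ n ∈ Icc 1 Y, ((lo U vonMangoldt n : ℝ) : ℂ) * Gf γ k N d a n = 0 := by
    apply sum_eq_zero
    intro n _
    rcases le_or_gt (n : ℝ) U with h | h
    · rw [hGU n (by linarith), mul_zero]
    · rw [lo_of_gt h]; simp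
  -- piece 2
  have p2 : ‖∑ n ∈ Icc 1 Y, (((lo U mu * ArithmeticFunction.log) n : ℝ) : ℂ) * Gf γ k N d a n‖
      ≤ 2 * C1 * Lg ^ 4 * B := by
    rw [conv_sum _ _ _ Y hGY]
    have e1 : ∑ l ∈ Icc 1 Y, ∑ m ∈ Icc 1 Y, ((lo U mu l : ℝ) : ℂ) *
        ((ArithmeticFunction.log m : ℝ) : ℂ) * Gf γ k N d a (l * m)
        = ∑ l ∈ Icc 1 Y, ((lo U mu l : ℝ) : ℂ) *
          (∑ m ∈ Icc 1 Y, ((Real.log m : ℝ) : ℂ) * Gf γ k N d a (l * m)) := by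
      apply sum_congr rfl
      intro l _
      rw [mul_sum]
      apply sum_congr rfl
      intro m _
      rw [ArithmeticFunction.log_apply, mul_assoc]
    rw [e1]
    refine (typeI_sum (fun l => lo U mu l) _ Y (2 * Lg * C1) (N / (d * P)) Lg ?_ (by positivity)
      hH).trans ?_
    · intro l hl
      rw [mem_Icc] at hl
      have hl' : (1 : ℝ) ≤ l := by exact_mod_cast hl.1
      rcases le_or_gt (l : ℝ) U with h | h
      · obtain ⟨c1, c2⟩ := cond l hl.1 h
        have := (hI N k P d l Y a (by linarith) hd hP hl.1 ha hT1 c1 c2).2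
        have hlog : Real.log (4 * (N / l)) ≤ Lg := by
          have : 4 * (N / l) ≤ 8 * N := by
            have : N / l ≤ N := div_le_self (by linarith) hl'
            linarith
          have := Real.log_le_log (by positivity) this
          linarith
        have hm := (abs_lo_le U mu l).trans (abs_mu_le l)
        calc |lo U mu l| * _ ≤ 1 * (2 * Real.log (4 * (N / l)) * (C1 * (N / l / d / P))) :=
              mul_le_mul hm this (norm_nonneg _) zero_le_one
          _ ≤ 1 * (2 * Lg * (C1 * (N / l / d / P))) := by gcongr
          _ = _ := by field_simp
      · rw [lo_of_gt h]
        simp only [abs_zero, zero_mul]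
        positivity
    · calc 2 * Lg * C1 * (N / (d * P)) * Lg = 2 * C1 * Lg ^ 2 * (N / (d * P)) := by ring
        _ ≤ 2 * C1 * Lg ^ 4 * B := by
            gcongr 2 * C1 * ?_ * ?_
            exact pow_le_pow_right₀ hLg1 (by norm_num)
  -- piece 3a
  have p3 : ‖∑ n ∈ Icc 1 Y, (((lo U (cc U) * ze) n : ℝ) : ℂ) * Gf γ k N d a n‖
      ≤ C1 * Lg ^ 4 * B := by
    rw [conv_sum _ _ _ Y hGY]
    have e1 : ∑ l ∈ Icc 1 Y, ∑ m ∈ Icc 1 Y, ((lo U (cc U) l : ℝ) : ℂ) *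
        ((ze m : ℝ) : ℂ) * Gf γ k N d a (l * m)
        = ∑ l ∈ Icc 1 Y, ((lo U (cc U) l : ℝ) : ℂ) *
          (∑ m ∈ Icc 1 Y, Gf γ k N d a (l * m)) := by
      apply sum_congr rfl
      intro l _
      rw [mul_sum]
      apply sum_congr rfl
      intro m hm
      rw [mem_Icc] at hm
      rw [ze_apply m (by omega)]; simp
    rw [e1]
    refine (typeI_sum (fun l => lo U (cc U) l) _ Y (Lg * C1) (N / (d * P)) Lg ?_ (by positivity)
      hH).trans ?_
    · intro l hl
      rw [mem_Icc] at hl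
      have hl' : (1 : ℝ) ≤ l := by exact_mod_cast hl.1
      rcases le_or_gt (l : ℝ) U with h | h
      · obtain ⟨c1, c2⟩ := cond l hl.1 h
        have := (hI N k P d l Y a (by linarith) hd hP hl.1 ha hT1 c1 c2).1
        have hm : |lo U (cc U) l| ≤ Lg := (abs_lo_le U (cc U) l).trans
          ((abs_cc_le U l).trans (hlogle l hl.1 (by linarith)))
        calc |lo U (cc U) l| * _ ≤ Lg * (C1 * (N / l / d / P)) :=
              mul_le_mul hm this (norm_nonneg _) (by linarith)
          _ = _ := by field_simp
      · rw [lo_of_gt h]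
        simp only [abs_zero, zero_mul]
        positivity
    · calc Lg * C1 * (N / (d * P)) * Lg = C1 * Lg ^ 2 * (N / (d * P)) := by ring
        _ ≤ C1 * Lg ^ 4 * B := by
            gcongr C1 * ?_ * ?_
            exact pow_le_pow_right₀ hLg1 (by norm_num)
  have hfin : ((Nat.log 2 Y : ℕ) + 1 : ℝ) * (C2 * Lg ^ 3 * B) ≤ 2 * C2 * Lg ^ 4 * B := by
    calc _ ≤ (2 * Lg) * (C2 * Lg ^ 3 * B) := by
          apply mul_le_mul_of_nonneg_right (natlog_le N hN)
          positivity
      _ = _ := by ring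
  -- piece 3b
  have p4 : ‖∑ n ∈ Icc 1 Y, (((hi U (cc U) * ze) n : ℝ) : ℂ) * Gf γ k N d a n‖
      ≤ 2 * C2 * Lg ^ 4 * B := by
    rw [conv_sum _ _ _ Y hGY]
    have e1 : ∑ l ∈ Icc 1 Y, ∑ m ∈ Icc 1 Y, ((hi U (cc U) l : ℝ) : ℂ) *
        ((ze m : ℝ) : ℂ) * Gf γ k N d a (l * m)
        = ∑ l ∈ Icc 1 Y, ∑ m ∈ Icc 1 Y, ((hi U (cc U) l : ℝ) : ℂ) *
        ((hi U ze m : ℝ) : ℂ) * Gf γ k N d a (l * m) := by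
      apply sum_congr rfl
      intro l _
      apply sum_congr rfl
      intro m _
      rcases le_or_gt (m : ℝ) U with h | h
      · rcases le_or_gt (l : ℝ) (U ^ 2) with h' | h'
        · rw [hGU, mul_zero, mul_zero]
          push_cast
          have : (l : ℝ) * m ≤ U ^ 2 * U := mul_le_mul h' h (by positivity) (by positivity)
          have e : U ^ 2 * U = U ^ 3 := by ring
          linarith
        · have : hi U (cc U) l = 0 := by
            have := abs_hi_le U (cc U) l
            rw [cc_zero (by linarith) h', abs_zero] at this
            exact abs_nonpos_iff.1 this
          rw [this]; simp
      · rw [hi_of_gt h]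
    rw [e1]
    refine (hII N k P Lg d a (fun l => hi U (cc U) l) (fun m => hi U ze m) hN hd hP ha
      (by linarith) h3 h4 h5 (fun n hn => hi_of_le hn) (fun n hn => hi_of_le hn) ?_ ?_).trans hfin
    · refine l2_of_sup _ N Lg hLg1 ?_
      intro n hn hn2
      exact (abs_hi_le U (cc U) n).trans ((abs_cc_le U n).trans (hlogle n hn hn2))
    · refine l2_of_sup _ N Lg hLg1 ?_
      intro n hn hn2
      refine (abs_hi_le U ze n).trans ?_
      rw [ze_apply n (by omega)]
      simpa using hLg1
  have p5 : ‖∑ n ∈ Icc 1 Y, (((hi U vonMangoldt * (hi U mu * ze)) n : ℝ) : ℂ) * Gf γ k N d a n‖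
      ≤ 2 * C2 * Lg ^ 4 * B := by
    rw [conv_sum _ _ _ Y hGY]
    refine (hII N k P Lg d a (fun l => hi U vonMangoldt l) (fun m => (hi U mu * ze) m) hN hd hP ha
      (by linarith) h3 h4 h5 (fun n hn => hi_of_le hn) (fun n hn => hmz_zero hn) ?_ ?_).trans hfin
    · refine l2_of_sup _ N Lg hLg1 ?_
      intro n hn hn2
      refine (abs_hi_le U vonMangoldt n).trans ?_
      rw [abs_of_nonneg vonMangoldt_nonneg]
      exact vonMangoldt_le_log.trans (hlogle n hn hn2)
    · intro x hx hxN
      rcases lt_or_ge x 1 with h | h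
      · rw [Nat.floor_eq_zero.2 h]
        simp only [Nat.lt_add_one, Icc_eq_empty_of_lt, sum_empty, Nat.lt_one_iff]
        positivity
      · calc ∑ n ∈ Icc 1 ⌊x⌋₊, (hi U mu * ze) n ^ 2
            ≤ ∑ n ∈ Icc 1 ⌊x⌋₊, (n.divisors.card : ℝ) ^ 2 := by
              apply sum_le_sum
              intro n _
              rw [← sq_abs]
              gcongr
              exact abs_hmz_le U n
          _ ≤ x * (1 + Real.log x) ^ 3 := tau_sq x h
          _ ≤ x * Lg ^ 3 := by
              have := Real.log_nonneg h
              rw [hLg]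
              gcongr
  have hsum : ∑ n ∈ Icc 1 Y, ((vonMangoldt n : ℝ) : ℂ) * Gf γ k N d a n
      = ∑ n ∈ Icc 1 Y, ((lo U vonMangoldt n : ℝ) : ℂ) * Gf γ k N d a n
      + ∑ n ∈ Icc 1 Y, (((lo U mu * ArithmeticFunction.log) n : ℝ) : ℂ) * Gf γ k N d a n
      - ∑ n ∈ Icc 1 Y, (((lo U (cc U) * ze) n : ℝ) : ℂ) * Gf γ k N d a n
      - ∑ n ∈ Icc 1 Y, (((hi U (cc U) * ze) n : ℝ) : ℂ) * Gf γ k N d a n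
      + ∑ n ∈ Icc 1 Y, (((hi U vonMangoldt * (hi U mu * ze)) n : ℝ) : ℂ) * Gf γ k N d a n := by
    rw [← sum_add_distrib, ← sum_sub_distrib, ← sum_sub_distrib, ← sum_add_distrib]
    apply sum_congr rfl
    intro n _
    have hv : (vonMangoldt n : ℝ) = lo U vonMangoldt n + (lo U mu * ArithmeticFunction.log) n
        - (lo U (cc U) * ze) n - (hi U (cc U) * ze) n
        + (hi U vonMangoldt * (hi U mu * ze)) n := DFunLike.congr_fun (vaughan U) n
    rw [hv]
    push_cast
    ring
  rw [hsum, p1, zero_add]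
  refine (norm_add_le _ _).trans ?_
  have q1 := norm_sub_le (∑ n ∈ Icc 1 Y, (((lo U mu * ArithmeticFunction.log) n : ℝ) : ℂ) * Gf γ k N d a n
      - ∑ n ∈ Icc 1 Y, (((lo U (cc U) * ze) n : ℝ) : ℂ) * Gf γ k N d a n)
      (∑ n ∈ Icc 1 Y, (((hi U (cc U) * ze) n : ℝ) : ℂ) * Gf γ k N d a n)
  have q2 := norm_sub_le (∑ n ∈ Icc 1 Y, (((lo U mu * ArithmeticFunction.log) n : ℝ) : ℂ) * Gf γ k N d a n)
      (∑ n ∈ Icc 1 Y, (((lo U (cc U) * ze) n : ℝ) : ℂ) * Gf γ k N d a n)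
  calc _ ≤ (2 * C1 * Lg ^ 4 * B + C1 * Lg ^ 4 * B + 2 * C2 * Lg ^ 4 * B) + 2 * C2 * Lg ^ 4 * B := by
        linarith
    _ = _ := by ring

end PS

namespace PS
open Finset ArithmeticFunction

/-- the summable majorant -/
noncomputable def ww (k : ℤ) : ℝ := |(k : ℝ)| ^ (-(9 / 8 : ℝ)) + if k = 0 then 1 else 0

lemma summable_ww : Summable ww := by
  apply Summable.add
  · exact Real.summable_abs_int_rpow (by norm_num)
  · exact (hasSum_ite_eq (0 : ℤ) (1 : ℝ)).summable

lemma ww_zero : ww 0 = 1 := by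
  unfold ww
  simp only [Int.cast_zero, abs_zero, if_true]
  rw [Real.zero_rpow (by norm_num), zero_add]

lemma ww_ne {k : ℤ} (h : k ≠ 0) : ww k = |(k : ℝ)| ^ (-(9 / 8 : ℝ)) := by
  unfold ww
  rw [if_neg h, add_zero]

lemma ww_nonneg (k : ℤ) : 0 ≤ ww k := by
  unfold ww
  split_ifs <;> positivity

lemma one_le_abs_int {k : ℤ} (h : k ≠ 0) : 1 ≤ |(k : ℝ)| := by
  have := Int.one_le_abs h
  exact_mod_cast this

/-- weights: middle range -/
lemma w_mid {k : ℤ} (h : k ≠ 0) {H : ℝ} (hH : 1 ≤ H) (hk : |(k : ℝ)| ≤ H ^ 4) :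
    1 / |(k : ℝ)| * (1 / √(H ^ 3)) ≤ 1 / H * ww k := by
  rw [ww_ne h]
  have h1 := one_le_abs_int h
  set x := |(k : ℝ)|
  have hx : 0 < x := by linarith
  have hH0 : 0 < H := by linarith
  have h2 : x ^ (1 / 8 : ℝ) ≤ √H := by
    calc x ^ (1 / 8 : ℝ) ≤ (H ^ 4) ^ (1 / 8 : ℝ) := by gcongr
      _ = √H := by
          rw [Real.sqrt_eq_rpow, ← Real.rpow_natCast, ← Real.rpow_mul hH0.le]
          norm_num
  have h3 : √(H ^ 3) = H * √H := by
    rw [show H ^ 3 = H ^ 2 * H by ring, Real.sqrt_mul (by positivity), Real.sqrt_sq hH0.le]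
  have h4 : x ^ (-(9 / 8 : ℝ)) = 1 / x * (1 / x ^ (1 / 8 : ℝ)) := by
    rw [show (-(9 / 8 : ℝ)) = (-1) + (-(1 / 8)) by norm_num, Real.rpow_add hx, Real.rpow_neg hx.le,
      Real.rpow_one, Real.rpow_neg hx.le, one_div, one_div, one_div]
  rw [h3, h4]
  have hsH : 0 < √H := Real.sqrt_pos.2 hH0
  calc 1 / x * (1 / (H * √H)) = 1 / H * (1 / x * (1 / √H)) := by field_simp
    _ ≤ _ := by gcongr

/-- weights: tail -/
lemma w_tail {k : ℤ} (h : k ≠ 0) {H : ℝ} (hH : 1 ≤ H) (hk : H ^ 4 ≤ |(k : ℝ)|) :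
    H / (k : ℝ) ^ 2 ≤ 1 / H * ww k := by
  rw [ww_ne h, ← sq_abs (k : ℝ)]
  have h1 := one_le_abs_int h
  set x := |(k : ℝ)|
  have hx : 0 < x := by linarith
  have hH0 : 0 < H := by linarith
  have h2 : H ^ 2 ≤ x ^ (7 / 8 : ℝ) := by
    calc H ^ 2 = (H ^ 4) ^ (1 / 2 : ℝ) := by
          rw [← Real.sqrt_eq_rpow, show H ^ 4 = (H ^ 2) ^ 2 by ring, Real.sqrt_sq (by positivity)]
      _ ≤ x ^ (1 / 2 : ℝ) := by gcongr
      _ ≤ x ^ (7 / 8 : ℝ) := Real.rpow_le_rpow_of_exponent_le h1 (by norm_num)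
  have h4 : x ^ (-(9 / 8 : ℝ)) = x ^ (7 / 8 : ℝ) / x ^ 2 := by
    rw [show (-(9 / 8 : ℝ)) = 7 / 8 - (2 : ℕ) by norm_num, Real.rpow_sub hx, Real.rpow_natCast]
  rw [h4]
  calc H / x ^ 2 = 1 / H * (H ^ 2 / x ^ 2) := by field_simp
    _ ≤ _ := by gcongr

lemma w_sum {k : ℤ} (h : k ≠ 0) {H : ℝ} (hH : 1 ≤ H) : H / (k : ℝ) ^ 2 ≤ H * ww k := by
  rw [ww_ne h, ← sq_abs (k : ℝ), div_eq_mul_inv]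
  have h1 := one_le_abs_int h
  gcongr
  rw [← Real.rpow_natCast, ← Real.rpow_neg (by positivity)]
  exact Real.rpow_le_rpow_of_exponent_le h1 (by norm_num)

lemma perd (γ : ℝ) (h0 : 1 / 2 ≤ γ) (hγ1 : γ < 1) : ∃ C, 1 ≤ C ∧
    ∀ (N H K t : ℝ) (d : ℕ) (a : ℤ) (b : ℤ → ℂ), 2 ≤ t → N = t ^ 40 → 1 ≤ H → H ≤ t →
    d * H ^ 8 ≤ t ^ 8 → N / H ≤ N ^ γ → 1 ≤ d → Int.gcd (d : ℤ) a = 1 → 0 < K →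
    (∀ k : ℤ, k ≠ 0 →
          ‖b k‖ ≤ K * min (Real.log (2 * H) / H) (min (1 / |(k : ℝ)|) (H / (k : ℝ) ^ 2))) →
    ‖b 0‖ ≤ K * (Real.log (2 * H) / H) →
    ‖∑ n ∈ (Finset.Ioc ⌊N⌋₊ ⌊2 * N⌋₊).filter (fun n : ℕ => (d : ℤ) ∣ ((n : ℤ) - a)),
              ((vonMangoldt n : ℝ) : ℂ) * ∑' k : ℤ, b k * e ((k : ℝ) * (n : ℝ) ^ γ)‖
      ≤ C * K * (1 + Real.log (8 * N)) ^ 4 * (N / (d * H)) := by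
  obtain ⟨C, hC1, hC⟩ := core γ h0 hγ1
  set Z := ∑' k, ww k with hZ
  have hZ0 : 0 ≤ Z := tsum_nonneg ww_nonneg
  refine ⟨(C + 4) * (Z + 1), by nlinarith, ?_⟩
  intro N H K t d a b ht hN hH hHt hdH hNH hd ha hK hb hb0
  have ht1 : 1 ≤ t := by linarith
  have hN1 : 1 ≤ N := by rw [hN]; exact one_le_pow₀ ht1
  have hd' : (1 : ℝ) ≤ d := by exact_mod_cast hd
  have hH0 : 0 < H := by linarith
  set Lg := 1 + Real.log (8 * N) with hLg
  have hLg1 : 1 ≤ Lg := by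
    have := Real.log_nonneg (show 1 ≤ 8 * N by linarith)
    linarith
  have htN : t ≤ N := by rw [hN]; exact le_self_pow₀ ht1 (by norm_num)
  set I := (Finset.Ioc ⌊N⌋₊ ⌊2 * N⌋₊).filter (fun n : ℕ => (d : ℤ) ∣ ((n : ℤ) - a)) with hI
  have memI : ∀ n, n ∈ I ↔ N < (n : ℝ) ∧ (n : ℝ) ≤ 2 * N ∧ (d : ℤ) ∣ (n : ℤ) - a := by
    intro n
    rw [hI, mem_filter, mem_Ioc, Nat.floor_lt (by linarith), Nat.le_floor_iff (by linarith), and_assoc]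
  set W : ℤ → ℂ := fun k => ∑ n ∈ I, ((vonMangoldt n : ℝ) : ℂ) * e ((k : ℝ) * (n : ℝ) ^ γ) with hW
  -- trivial bound
  have hdN : (d : ℝ) ≤ N := by
    have h1 : (d : ℝ) * 1 ≤ d * H ^ 8 := by
      gcongr
      exact one_le_pow₀ hH
    have h2 : t ^ 8 ≤ t ^ 40 := pow_le_pow_right₀ ht1 (by norm_num)
    linarith
  have hAP : IsAP d I := by
    apply isAP_filter ha N 1 1 0 ⌊2 * N⌋₊ I
    intro x
    rw [memI]
    simp only [one_mul, mem_Icc, Nat.zero_le, true_and]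
    constructor
    · intro h
      exact ⟨Nat.le_floor h.2.1, h, h⟩
    · exact fun h => h.2.1
  have hcard : (I.card : ℝ) ≤ 4 * (N / d) := by
    apply hAP.card_le hd N _ hdN
    intro x hx
    rw [memI] at hx
    exact ⟨hx.1.le, by linarith [hx.2.1]⟩
  have hWtriv : ∀ k, ‖W k‖ ≤ 4 * Lg * (N / d) := by
    intro k
    calc ‖W k‖ ≤ ∑ n ∈ I, ‖((vonMangoldt n : ℝ) : ℂ) * e ((k : ℝ) * (n : ℝ) ^ γ)‖ :=
          norm_sum_le _ _
      _ ≤ ∑ n ∈ I, Lg := by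
          apply sum_le_sum
          intro n hn
          rw [memI] at hn
          rw [norm_mul, norm_e, mul_one, Complex.norm_real, Real.norm_eq_abs,
            abs_of_nonneg vonMangoldt_nonneg]
          refine vonMangoldt_le_log.trans ?_
          have : Real.log n ≤ Real.log (8 * N) := Real.log_le_log (by linarith) (by linarith)
          linarith
      _ = I.card * Lg := by rw [sum_const, nsmul_eq_mul]
      _ ≤ (4 * (N / d)) * Lg := by gcongr
      _ = _ := by ring
  have hWG : ∀ k : ℤ, W k = ∑ n ∈ Icc 1 ⌊2 * N⌋₊, ((vonMangoldt n : ℝ) : ℂ) * Gf γ k N d a n := by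
    intro k
    have hsub : I ⊆ Icc 1 ⌊2 * N⌋₊ := by
      intro n hn
      rw [memI] at hn
      rw [mem_Icc]
      refine ⟨?_, Nat.le_floor hn.2.1⟩
      have : (0 : ℝ) < n := by linarith
      exact_mod_cast this
    rw [← sum_subset hsub]
    · apply sum_congr rfl
      intro n hn
      rw [memI] at hn
      congr 1
      unfold Gf
      exact (if_pos hn).symm
    · intro n _ hn
      rw [memI] at hn
      have : Gf γ k N d a n = 0 := by
        unfold Gf
        exact if_neg hn
      rw [this, mul_zero]
  have hNsqrt : √N = t ^ 20 := by
    rw [hN, show t ^ 40 = (t ^ 20) ^ 2 by ring, Real.sqrt_sq (by positivity)]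
  have hNγ : N ^ γ ≤ N := by
    calc N ^ γ ≤ N ^ (1 : ℝ) := Real.rpow_le_rpow_of_exponent_le hN1 hγ1.le
      _ = N := Real.rpow_one N
  have hNγ0 : 0 ≤ N ^ γ := by positivity
  have hWmid : ∀ k : ℤ, k ≠ 0 → |(k : ℝ)| ≤ H ^ 4 →
      ‖W k‖ ≤ C * Lg ^ 4 * (N / (d * √(H ^ 3))) := by
    intro k hk hk4
    have hk1 := one_le_abs_int hk
    rw [hWG k]
    apply hC N k (H ^ 3) d a hN1 hd (one_le_pow₀ hH) ha
    · rw [hNsqrt]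
      have h1 : N / H ≤ |(k : ℝ)| * N ^ γ := hNH.trans (le_mul_of_one_le_left hNγ0 hk1)
      refine le_trans ?_ h1
      rw [le_div_iff₀ hH0, hN]
      calc 16 * (H ^ 3) ^ 2 * t ^ 20 * H = 2 ^ 4 * H ^ 7 * t ^ 20 := by ring
        _ ≤ t ^ 4 * t ^ 7 * t ^ 20 := by gcongr
        _ = t ^ 31 := by ring
        _ ≤ t ^ 40 := pow_le_pow_right₀ ht1 (by norm_num)
    · calc 8 * (|(k : ℝ)| * N ^ γ) * d ^ 4 * (H ^ 3) ^ 7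
          ≤ 8 * (H ^ 4 * N) * d ^ 4 * (H ^ 3) ^ 7 := by gcongr
        _ = 8 * (d ^ 4 * H ^ 25) * N := by ring
        _ ≤ 8 * (d ^ 4 * H ^ 32) * N := by
            gcongr 8 * (d ^ 4 * ?_) * N
            exact pow_le_pow_right₀ hH (by norm_num)
        _ = 2 ^ 3 * (d * H ^ 8) ^ 4 * N := by ring
        _ ≤ t ^ 3 * (t ^ 8) ^ 4 * N := by gcongr
        _ = t ^ 35 * N := by ring
        _ ≤ t ^ 40 * N := by
            gcongr ?_ * N
            exact pow_le_pow_right₀ ht1 (by norm_num)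
        _ = N ^ 2 := by rw [hN]; ring
    · rw [hNsqrt]
      calc 2 * (H ^ 3) ^ 6 * d = 2 * (d * H ^ 8) * H ^ 10 := by ring
        _ ≤ t * t ^ 8 * t ^ 10 := by gcongr
        _ = t ^ 19 := by ring
        _ ≤ t ^ 20 := pow_le_pow_right₀ ht1 (by norm_num)
    · calc (d * H ^ 3) ^ 3 ≤ (d * H ^ 8) ^ 3 := by
            gcongr
            norm_num
        _ ≤ (t ^ 8) ^ 3 := by gcongr
        _ = t ^ 24 := by ring
        _ < t ^ 40 := pow_lt_pow_right₀ (by linarith) (by norm_num)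
        _ = N := hN.symm
  set R := (C + 4) * K * Lg ^ 4 * (N / (d * H)) with hR
  have hR0 : 0 ≤ R := by rw [hR]; positivity
  have hLg4 : Lg ≤ Lg ^ 4 := le_self_pow₀ hLg1 (by norm_num)
  have hLg24 : Lg ^ 2 ≤ Lg ^ 4 := pow_le_pow_right₀ hLg1 (by norm_num)
  -- pointwise
  have hpt : ∀ k : ℤ, ‖b k * W k‖ ≤ R * ww k := by
    intro k
    rw [norm_mul]
    by_cases hk : k = 0
    · subst hk
      rw [ww_zero, mul_one]
      have hlog : Real.log (2 * H) ≤ Lg := by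
        have : Real.log (2 * H) ≤ Real.log (8 * N) := Real.log_le_log (by linarith) (by linarith)
        linarith
      calc ‖b 0‖ * ‖W 0‖ ≤ (K * (Lg / H)) * (4 * Lg * (N / d)) := by
            apply mul_le_mul _ (hWtriv 0) (norm_nonneg _) (by positivity)
            refine hb0.trans ?_
            gcongr
        _ = 4 * K * Lg ^ 2 * (N / (d * H)) := by field_simp
        _ ≤ (C + 4) * K * Lg ^ 4 * (N / (d * H)) := by
            gcongr
            linarith
    · have hbk := hb k hk
      have hk1 := one_le_abs_int hk
      rcases le_or_gt |(k : ℝ)| (H ^ 4) with h | h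
      · have hb1 : ‖b k‖ ≤ K * (1 / |(k : ℝ)|) := hbk.trans (by
          gcongr
          exact (min_le_right _ _).trans (min_le_left _ _))
        calc ‖b k‖ * ‖W k‖ ≤ (K * (1 / |(k : ℝ)|)) * (C * Lg ^ 4 * (N / (d * √(H ^ 3)))) :=
              mul_le_mul hb1 (hWmid k hk h) (norm_nonneg _) (by positivity)
          _ = C * K * Lg ^ 4 * (N / d) * (1 / |(k : ℝ)| * (1 / √(H ^ 3))) := by
              field_simp
          _ ≤ C * K * Lg ^ 4 * (N / d) * (1 / H * ww k) := by
              have := w_mid hk hH h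
              gcongr
          _ = C * K * Lg ^ 4 * (N / (d * H)) * ww k := by field_simp
          _ ≤ _ := by
              apply mul_le_mul_of_nonneg_right _ (ww_nonneg k)
              rw [hR]
              gcongr
              linarith
      · have hb1 : ‖b k‖ ≤ K * (1 / H * ww k) := hbk.trans (by
          gcongr
          exact ((min_le_right _ _).trans (min_le_right _ _)).trans (w_tail hk hH h.le))
        have := ww_nonneg k
        calc ‖b k‖ * ‖W k‖ ≤ (K * (1 / H * ww k)) * (4 * Lg * (N / d)) :=
              mul_le_mul hb1 (hWtriv k) (norm_nonneg _) (by positivity)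
          _ = 4 * K * Lg * (N / (d * H)) * ww k := by field_simp
          _ ≤ _ := by
              apply mul_le_mul_of_nonneg_right _ this
              rw [hR]
              gcongr
              linarith
  -- summability
  have hsb : ∀ n : ℕ, Summable (fun k : ℤ => b k * e ((k : ℝ) * (n : ℝ) ^ γ)) := by
    intro n
    apply Summable.of_norm_bounded (g := fun k => (K * H + ‖b 0‖) * ww k)
      (summable_ww.mul_left _)
    intro k
    rw [norm_mul, norm_e, mul_one]
    by_cases hk : k = 0
    · subst hk
      rw [ww_zero, mul_one]
      have : 0 ≤ K * H := by positivity
      linarith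
    · have := ww_nonneg k
      calc ‖b k‖ ≤ K * (H * ww k) := (hb k hk).trans (by
            gcongr
            exact ((min_le_right _ _).trans (min_le_right _ _)).trans (w_sum hk hH))
        _ = (K * H + 0) * ww k := by ring
        _ ≤ _ := by gcongr; positivity
  have hswap : ∑ n ∈ I, ((vonMangoldt n : ℝ) : ℂ) * ∑' k : ℤ, b k * e ((k : ℝ) * (n : ℝ) ^ γ)
      = ∑' k : ℤ, b k * W k := by
    simp_rw [← tsum_mul_left]
    rw [← Summable.tsum_finsetSum (fun n _ => (hsb n).mul_left _)]
    congr 1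
    ext k
    simp only [hW]
    rw [mul_sum]
    apply sum_congr rfl
    intro n _
    ring
  rw [hswap]
  refine (tsum_of_norm_bounded (summable_ww.hasSum.mul_left R) hpt).trans ?_
  rw [← hZ]
  calc R * Z ≤ R * (Z + 1) := by gcongr; linarith
    _ = _ := by rw [hR]; ring

end PS

open scoped Classical in
/-- Estimate for `Γ₂` (and `Γ₃`): with `θ = (443/55)γ - 173/22 - ε`, `D = X^θ`,
`γ > 1/2 + θ`, `X^{1-ε} ≤ N ≤ X`, `H = N^{1-γ+ε}`, and Fourier coefficients `b_k` with
`|b_k| ≪ min((log 2H)/H, 1/|k|, H/k²)` for `k ≠ 0` and `|b_0| ≪ (log 2H)/H`,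
`∑_{d ≤ D, (d,a)=1} |∑_{n ∼ N, n ≡ a (d)} Λ(n) ∑_k b_k e(k n^γ)| ≪ X^γ/(log X)^A`. -/
theorem Gamma2_estimate (γ : ℝ) (hγ₁ : 865 / 886 < γ) (hγ₂ : γ < 1)
    (a : ℤ) (ha : a ≠ 0) (A : ℝ) (hA : 0 < A) :
    ∃ ε₀ : ℝ, 0 < ε₀ ∧ ∀ ε : ℝ, 0 < ε → ε < ε₀ → ∀ K : ℝ, 0 < K →
      ∃ C : ℝ, 0 < C ∧ ∃ X₀ : ℝ, ∀ X : ℝ, X₀ ≤ X →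
      ∀ N H : ℝ, ∀ b : ℤ → ℂ,
        γ > 1 / 2 + ((443 / 55) * γ - 173 / 22 - ε) →
        X ^ (1 - ε) ≤ N → N ≤ X →
        H = N ^ (1 - γ + ε) →
        (∀ k : ℤ, k ≠ 0 →
          ‖b k‖ ≤ K * min (Real.log (2 * H) / H) (min (1 / |(k : ℝ)|) (H / (k : ℝ) ^ 2))) →
        ‖b 0‖ ≤ K * (Real.log (2 * H) / H) →
        ∑ d ∈ (Finset.Icc 1 ⌊X ^ ((443 / 55) * γ - 173 / 22 - ε)⌋₊).filter
            (fun d : ℕ => Int.gcd (d : ℤ) a = 1),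
          ‖∑ n ∈ (Finset.Ioc ⌊N⌋₊ ⌊2 * N⌋₊).filter
                (fun n : ℕ => (d : ℤ) ∣ ((n : ℤ) - a)),
              ((ArithmeticFunction.vonMangoldt n : ℝ) : ℂ) *
                ∑' k : ℤ, b k * e ((k : ℝ) * (n : ℝ) ^ γ)‖
        ≤ C * X ^ γ / (Real.log X) ^ A := by
  obtain ⟨C, hC1, hC⟩ := PS.perd γ (by linarith) hγ₂
  refine ⟨1 / 1000, by norm_num, ?_⟩
  intro ε hε hε1 K hK
  refine ⟨C * K * 5 ^ 5, by positivity, ?_⟩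
  have hlit : ∀ᶠ X : ℝ in Filter.atTop, Real.log X ^ (5 + A) ≤ X ^ ε := by
    have h := (isLittleO_log_rpow_rpow_atTop (5 + A) hε).bound (show (0 : ℝ) < 1 by norm_num)
    filter_upwards [h, Filter.eventually_ge_atTop (1 : ℝ)] with X h1 h2
    rw [one_mul, Real.norm_of_nonneg (show (0 : ℝ) ≤ X ^ ε from Real.rpow_nonneg (by linarith) _)] at h1
    exact (le_abs_self _).trans h1
  obtain ⟨X1, hX1⟩ := Filter.eventually_atTop.1 hlit
  refine ⟨max X1 (2 ^ 80), ?_⟩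
  intro X hX N H b _ hNX hNX' hH hb hb0
  have hXlog := hX1 X ((le_max_left _ _).trans hX)
  have hX80 : (2 : ℝ) ^ 80 ≤ X := (le_max_right _ _).trans hX
  have hXge1 : (1 : ℝ) ≤ X := le_trans (by norm_num) hX80
  have hX0 : 0 < X := by linarith
  have hN40 : (2 : ℝ) ^ 40 ≤ N := by
    refine le_trans ?_ hNX
    calc (2 : ℝ) ^ 40 = ((2 : ℝ) ^ 80) ^ (1 / 2 : ℝ) := by
          rw [← Real.sqrt_eq_rpow, show (2 : ℝ) ^ 80 = (2 ^ 40) ^ 2 by norm_num,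
            Real.sqrt_sq (by positivity)]
      _ ≤ X ^ (1 / 2 : ℝ) := by gcongr
      _ ≤ X ^ (1 - ε) := Real.rpow_le_rpow_of_exponent_le hXge1 (by linarith)
  have hN1 : (1 : ℝ) ≤ N := le_trans (by norm_num) hN40
  have hN0 : 0 < N := by linarith
  set t := N ^ (1 / 40 : ℝ) with ht
  have htN : N = t ^ 40 := by
    rw [ht, ← Real.rpow_natCast, ← Real.rpow_mul hN0.le]; norm_num
  have ht2 : 2 ≤ t := by
    calc (2 : ℝ) = ((2 : ℝ) ^ 40) ^ (1 / 40 : ℝ) := by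
          rw [← Real.rpow_natCast, ← Real.rpow_mul (by norm_num)]; norm_num
      _ ≤ t := by rw [ht]; gcongr
  have hH1 : 1 ≤ H := by rw [hH]; exact Real.one_le_rpow hN1 (by linarith)
  have hHt : H ≤ t := by
    rw [hH, ht]; exact Real.rpow_le_rpow_of_exponent_le hN1 (by linarith)
  have hNH : N / H ≤ N ^ γ := by
    rw [hH]
    nth_rw 1 [← Real.rpow_one N]
    rw [← Real.rpow_sub hN0]
    exact Real.rpow_le_rpow_of_exponent_le hN1 (by linarith)
  set θ := (443 / 55) * γ - 173 / 22 - ε with hθ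
  set Lg := 1 + Real.log (8 * N) with hLg
  have hlogX : 2 ≤ Real.log X := by
    have h1 := Real.log_le_log (by positivity) hX80
    rw [Real.log_pow] at h1
    have := Real.log_two_gt_d9
    push_cast at h1
    linarith
  have hLg5 : Lg ≤ 5 * Real.log X := by
    have h1 : Real.log (8 * N) ≤ Real.log (8 * X) := Real.log_le_log (by positivity) (by linarith)
    rw [Real.log_mul (by norm_num) hX0.ne', show (8 : ℝ) = 2 ^ 3 by norm_num, Real.log_pow] at h1
    have := Real.log_two_lt_d9
    push_cast at h1
    have e : (2 : ℝ) ^ 3 * N = 8 * N := by norm_num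
    rw [e] at h1
    linarith
  have hLg0 : 0 ≤ Lg := by
    have := Real.log_nonneg (show 1 ≤ 8 * N by linarith)
    linarith
  have hterm : ∀ d ∈ (Finset.Icc 1 ⌊X ^ θ⌋₊).filter (fun d : ℕ => Int.gcd (d : ℤ) a = 1),
      ‖∑ n ∈ (Finset.Ioc ⌊N⌋₊ ⌊2 * N⌋₊).filter
                (fun n : ℕ => (d : ℤ) ∣ ((n : ℤ) - a)),
              ((ArithmeticFunction.vonMangoldt n : ℝ) : ℂ) *
                ∑' k : ℤ, b k * e ((k : ℝ) * (n : ℝ) ^ γ)‖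
        ≤ C * K * Lg ^ 4 * (N / H) * (1 / (d : ℝ)) := by
    intro d hd
    rw [Finset.mem_filter, Finset.mem_Icc] at hd
    obtain ⟨⟨hd1, hd2⟩, hda⟩ := hd
    have hd1' : (1 : ℝ) ≤ d := by exact_mod_cast hd1
    have hdX : (d : ℝ) ≤ X ^ θ := (Nat.le_floor_iff (by positivity)).1 hd2
    have hθ0 : 0 ≤ θ := by
      by_contra hneg
      push Not at hneg
      have : X ^ θ < 1 := Real.rpow_lt_one_of_one_lt_of_neg (by linarith) hneg
      linarith
    have hXN : X ≤ N ^ (1 + 2 * ε) := by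
      calc X = X ^ (1 : ℝ) := (Real.rpow_one X).symm
        _ ≤ X ^ ((1 - ε) * (1 + 2 * ε)) := by
            apply Real.rpow_le_rpow_of_exponent_le hXge1
            nlinarith
        _ = (X ^ (1 - ε)) ^ (1 + 2 * ε) := Real.rpow_mul hX0.le _ _
        _ ≤ N ^ (1 + 2 * ε) := by gcongr
    have hdN : (d : ℝ) ≤ N ^ ((1 + 2 * ε) * θ) := by
      rw [Real.rpow_mul hN0.le]
      exact hdX.trans (Real.rpow_le_rpow hX0.le hXN hθ0)
    have hdH : d * H ^ 8 ≤ t ^ 8 := by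
      calc d * H ^ 8 ≤ N ^ ((1 + 2 * ε) * θ) * H ^ 8 := by gcongr
        _ = N ^ ((1 + 2 * ε) * θ + (1 - γ + ε) * 8) := by
            rw [hH, ← Real.rpow_natCast, ← Real.rpow_mul hN0.le, ← Real.rpow_add hN0]
            norm_num
        _ ≤ N ^ ((1 / 40 : ℝ) * 8) := by
            apply Real.rpow_le_rpow_of_exponent_le hN1
            have h1 : θ ≤ 1 / 5 := by rw [hθ]; linarith
            have h2 : 2 * ε * θ ≤ 2 * ε * (1 / 5) := by gcongr
            have h3 : (1 + 2 * ε) * θ = θ + 2 * ε * θ := by ring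
            rw [h3]
            have h4 : θ = (443 / 55) * γ - 173 / 22 - ε := hθ
            linarith
        _ = t ^ 8 := by
            rw [ht, ← Real.rpow_natCast (N ^ (1 / 40 : ℝ)), ← Real.rpow_mul hN0.le]
            norm_num
    have := hC N H K t d a b ht2 htN hH1 hHt hdH hNH hd1 hda hK hb hb0
    refine le_trans (le_of_eq ?_) (this.trans (le_of_eq ?_))
    · congr!
    · rw [← hLg]; field_simp
  refine (Finset.sum_le_sum hterm).trans ?_
  rw [← Finset.mul_sum]
  have hNHp : N / H ≤ X ^ γ / X ^ ε := by
    rw [hH]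
    nth_rw 1 [← Real.rpow_one N]
    rw [← Real.rpow_sub hN0, ← Real.rpow_sub hX0]
    calc N ^ (1 - (1 - γ + ε)) = N ^ (γ - ε) := by congr 1; ring
      _ ≤ X ^ (γ - ε) := by gcongr; linarith
  have hharm : ∑ d ∈ (Finset.Icc 1 ⌊X ^ θ⌋₊).filter (fun d : ℕ => Int.gcd (d : ℤ) a = 1),
      (1 / (d : ℝ)) ≤ 5 * Real.log X := by
    calc _ ≤ ∑ d ∈ Finset.Icc 1 ⌊X ^ θ⌋₊, (1 / (d : ℝ)) := by
          apply Finset.sum_le_sum_of_subset_of_nonneg (Finset.filter_subset _ _)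
          intro _ _ _; positivity
      _ ≤ 1 + Real.log X := by
          apply PS.harm_le _ X hXge1
          refine (Nat.floor_le (by positivity)).trans ?_
          calc X ^ θ ≤ X ^ (1 : ℝ) := Real.rpow_le_rpow_of_exponent_le hXge1
                (by rw [hθ]; linarith)
            _ = X := Real.rpow_one X
      _ ≤ _ := by linarith
  have hNHpos : 0 ≤ N / H := by positivity
  have hLp : 0 < Real.log X := by linarith
  calc C * K * Lg ^ 4 * (N / H) * _
      ≤ C * K * (5 * Real.log X) ^ 4 * (X ^ γ / X ^ ε) * (5 * Real.log X) := by gcongr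
    _ = C * K * 5 ^ 5 * X ^ γ * (Real.log X ^ 5 / X ^ ε) := by ring
    _ ≤ C * K * 5 ^ 5 * X ^ γ * (1 / Real.log X ^ A) := by
        apply mul_le_mul_of_nonneg_left _ (by positivity)
        rw [div_le_div_iff₀ (by positivity) (by positivity), one_mul]
        rw [Real.rpow_add hLp] at hXlog
        refine le_trans (le_of_eq ?_) hXlog
        congr 1
        rw [← Real.rpow_natCast]; norm_num
    _ = _ := by rw [mul_one_div]
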